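/- For every even integer k ≥ 4 there exists a plane triangulation D_k containing k pairwise disjoint copies of a fixed 16-vertex gadget such that s_{K4}(D_k) ≥ 12k and s_o(D_k) ≤ 23k/2; in particular, s_{K4}(D_k) − s_o(D_k) ≥ k/2. -/

import Mathlib

/-- A drawing (embedding) of a simple graph in the plane `ℝ × ℝ` without crossings:
vertices are mapped to distinct points, each edge to an injective arc joining its
endpoints, arcs pass through no other vertex, and two arcs of distinct edges meet
only in common endpoints. -/
structure PlaneEmbedding {V : Type} (G : SimpleGraph V) where
  vtx : V → ℝ × ℝ
  vtx_inj : Function.Injective vtx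
  arc : ∀ ⦃u v : V⦄, G.Adj u v → Set (ℝ × ℝ)
  arc_symm : ∀ ⦃u v : V⦄ (h : G.Adj u v), arc h.symm = arc h
  arc_path : ∀ ⦃u v : V⦄ (h : G.Adj u v),
    ∃ γ : Path (vtx u) (vtx v), Function.Injective ⇑γ ∧ Set.range ⇑γ = arc h
  arc_vtx : ∀ ⦃u v : V⦄ (h : G.Adj u v) (w : V), vtx w ∈ arc h → w = u ∨ w = v
  arc_inter : ∀ ⦃u v a b : V⦄ (h₁ : G.Adj u v) (h₂ : G.Adj a b), s(u, v) ≠ s(a, b) →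
    arc h₁ ∩ arc h₂ ⊆ ({vtx u, vtx v} : Set (ℝ × ℝ)) ∩ {vtx a, vtx b}

namespace PlaneEmbedding

variable {V : Type} {G : SimpleGraph V}

/-- The point set of the sub-drawing determined by the vertices in `S`
(the inherited embedding of the induced subgraph on `S`). -/
def subSupport (E : PlaneEmbedding G) (S : Set V) : Set (ℝ × ℝ) :=
  E.vtx '' S ∪ ⋃ (u : V) (_ : u ∈ S) (v : V) (_ : v ∈ S) (h : G.Adj u v), E.arc h

/-- The induced subgraph on `S`, with the inherited embedding, is an outerplane graph:
every vertex of `S` lies on the boundary of the outer (unbounded) face, i.e. in the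
closure of the set of points belonging to unbounded faces of the sub-drawing. -/
def OuterplaneOn (E : PlaneEmbedding G) (S : Set V) : Prop :=
  ∀ v ∈ S, E.vtx v ∈ closure {p | p ∉ E.subSupport S ∧
    ¬ Bornology.IsBounded (connectedComponentIn (E.subSupport S)ᶜ p)}

/-- The whole drawing is an outerplane graph. -/
def IsOuterplane (E : PlaneEmbedding G) : Prop := E.OuterplaneOn Set.univ

end PlaneEmbedding

/-- A graph is planar if it admits a plane embedding. -/
def IsPlanar {V : Type} (G : SimpleGraph V) : Prop := Nonempty (PlaneEmbedding G)

/-- A graph is outerplanar if it admits a plane embedding with all vertices on the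
boundary of the outer face. -/
def IsOuterplanar {V : Type} (G : SimpleGraph V) : Prop :=
  ∃ E : PlaneEmbedding G, E.IsOuterplane

/-- A plane triangulation is an edge-maximal (finite) planar graph. -/
def IsPlaneTriangulation {V : Type} (G : SimpleGraph V) : Prop :=
  IsPlanar G ∧ ∀ u v : V, u ≠ v → ¬ G.Adj u v →
    ¬ IsPlanar (G ⊔ SimpleGraph.fromEdgeSet {s(u, v)})

/-- `G` has a `K_m`-minor: there are `m` pairwise disjoint nonempty connected branch
sets with an edge between any two of them. -/
def HasCliqueMinor {V : Type} (G : SimpleGraph V) (m : ℕ) : Prop :=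
  ∃ B : Fin m → Set V,
    (∀ i, (B i).Nonempty) ∧
    (∀ i, (G.induce (B i)).Connected) ∧
    (∀ i j, i ≠ j → Disjoint (B i) (B j)) ∧
    (∀ i j, i ≠ j → ∃ u ∈ B i, ∃ v ∈ B j, G.Adj u v)

/-- `G` is `K₄`-minor free. -/
def K4MinorFree {V : Type} (G : SimpleGraph V) : Prop := ¬ HasCliqueMinor G 4

/-- `s_{o'}(G)` for a fixed plane embedding of `G`: the maximum order of an induced
subgraph whose inherited embedding is an outerplane graph. -/
noncomputable def sO' {V : Type} [Fintype V] {G : SimpleGraph V}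
    (E : PlaneEmbedding G) : ℕ :=
  sSup {n | ∃ S : Finset V, E.OuterplaneOn ↑S ∧ S.card = n}

/-- `s_o(G)`: the maximum order of an induced outerplanar subgraph of `G`. -/
noncomputable def sO {V : Type} [Fintype V] (G : SimpleGraph V) : ℕ :=
  sSup {n | ∃ S : Finset V, IsOuterplanar (G.induce (↑S : Set V)) ∧ S.card = n}

/-- `s_{K₄}(G)`: the maximum order of an induced `K₄`-minor-free subgraph of `G`. -/
noncomputable def sK4 {V : Type} [Fintype V] (G : SimpleGraph V) : ℕ :=
  sSup {n | ∃ S : Finset V, K4MinorFree (G.induce (↑S : Set V)) ∧ S.card = n}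

/-- `tw(G) ≤ k`: `G` admits a tree decomposition of width at most `k`. -/
def TreewidthLE {V : Type} (G : SimpleGraph V) (k : ℕ) : Prop :=
  ∃ (ι : Type) (T : SimpleGraph ι) (bag : ι → Set V),
    T.IsTree ∧
    (∀ v : V, ∃ i, v ∈ bag i) ∧
    (∀ u v : V, G.Adj u v → ∃ i, u ∈ bag i ∧ v ∈ bag i) ∧
    (∀ v : V, (T.induce {i | v ∈ bag i}).Connected) ∧
    (∀ i, (bag i).ncard ≤ k + 1)

/-- `G` is a `k`-tree: its vertices admit a construction order in which the first
`k+1` vertices form a complete graph and every later vertex is joined to exactly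
`k` earlier, pairwise adjacent, vertices. -/
def IsKTree (k : ℕ) {V : Type} (G : SimpleGraph V) : Prop :=
  ∃ (n : ℕ) (e : Fin n ≃ V), k + 1 ≤ n ∧
    (∀ i j : Fin n, (i : ℕ) < k + 1 → (j : ℕ) < k + 1 → i ≠ j → G.Adj (e i) (e j)) ∧
    (∀ j : Fin n, k + 1 ≤ (j : ℕ) →
      {i : Fin n | i < j ∧ G.Adj (e i) (e j)}.ncard = k ∧
      (∀ i i' : Fin n, i < j → i' < j → G.Adj (e i) (e j) → G.Adj (e i') (e j) →
        i ≠ i' → G.Adj (e i) (e i')))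

/-- `S` is a dominating set of `G`. -/
def IsDomSet {V : Type} (G : SimpleGraph V) (S : Set V) : Prop :=
  ∀ v : V, v ∈ S ∨ ∃ u ∈ S, G.Adj u v

/-- `S` is a connected dominating set of `G`. -/
def IsConnDomSet {V : Type} (G : SimpleGraph V) (S : Set V) : Prop :=
  IsDomSet G S ∧ (G.induce S).Connected

/-- The domination number `γ(G)`. -/
noncomputable def domNum {V : Type} [Fintype V] (G : SimpleGraph V) : ℕ :=
  sInf {n | ∃ S : Finset V, IsDomSet G ↑S ∧ S.card = n}

/-- The connected domination number `γ_c(G)`. -/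
noncomputable def connDomNum {V : Type} [Fintype V] (G : SimpleGraph V) : ℕ :=
  sInf {n | ∃ S : Finset V, IsConnDomSet G ↑S ∧ S.card = n}

/-- A graph is Eulerian if every vertex has even degree. -/
def IsEulerian {V : Type} (G : SimpleGraph V) : Prop :=
  ∀ v : V, Even (G.neighborSet v).ncard

/-- `G` contains a subgraph isomorphic to `H`. -/
def ContainsCopy {W V : Type} (H : SimpleGraph W) (G : SimpleGraph V) : Prop :=
  ∃ f : H →g G, Function.Injective ⇑f

/-- The complete tripartite graph `K_{1,1,3}`. -/
def K113 : SimpleGraph (Fin 5) :=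
  SimpleGraph.fromEdgeSet {s(0, 1), s(0, 2), s(0, 3), s(0, 4), s(1, 2), s(1, 3), s(1, 4)}

/-- `G` is a maximal outerplanar graph. -/
def IsMaximalOuterplanar {V : Type} (G : SimpleGraph V) : Prop :=
  IsOuterplanar G ∧ ∀ u v : V, u ≠ v → ¬ G.Adj u v →
    ¬ IsOuterplanar (G ⊔ SimpleGraph.fromEdgeSet {s(u, v)})

/-! ### Variation of the logarithm along a curve -/

theorem exists_continuous_log {A : Type} [TopologicalSpace A] [SimplyConnectedSpace A]
    [LocallyPathConnectedSpace A] {g : A → ℂ} (hg : Continuous g) (h0 : ∀ x, g x ≠ 0) :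
    ∃ f : A → ℂ, Continuous f ∧ ∀ x, Complex.exp (f x) = g x := by
  obtain ⟨x₀⟩ : Nonempty A := inferInstance
  obtain ⟨f, ⟨-, hf⟩, -⟩ := Complex.isCoveringMapOn_exp.existsUnique_continuousMap_lifts
    ⟨g, hg⟩ (Complex.exp_log (h0 x₀)) h0
  exact ⟨f, f.continuous, fun x => congrFun hf x⟩

theorem sub_eq_sub_of_exp_eq {f₁ f₂ : ℝ → ℂ} (h₁ : Continuous f₁) (h₂ : Continuous f₂)
    (h : ∀ x, Complex.exp (f₁ x) = Complex.exp (f₂ x)) (x y : ℝ) :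
    f₁ x - f₁ y = f₂ x - f₂ y := by
  obtain ⟨f, -, hu⟩ := Complex.isCoveringMapOn_exp.existsUnique_continuousMap_lifts
    ⟨fun x => Complex.exp (f₁ x), by fun_prop⟩ (a₀ := y) (e₀ := f₁ y) rfl
    (fun x => Complex.exp_ne_zero _)
  have e₁ := hu ⟨f₁, h₁⟩ ⟨rfl, rfl⟩
  have e₂ := hu ⟨fun x => f₂ x - f₂ y + f₁ y, by fun_prop⟩ ⟨by simp, by
    ext x
    simp [Complex.exp_add, Complex.exp_sub, h]⟩
  have := DFunLike.congr_fun (e₁.trans e₂.symm) x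
  simp only [ContinuousMap.coe_mk] at this
  rw [this]; ring

/-- The total variation of a continuous branch of `log g` over `[0, 1]`. -/
noncomputable def logVariation (g : ℝ → ℂ) : ℂ :=
  open Classical in
  if h : ∃ f : ℝ → ℂ, Continuous f ∧ ∀ x, Complex.exp (f x) = g x then
    h.choose 1 - h.choose 0 else 0

theorem logVariation_eq {g f : ℝ → ℂ} (hf : Continuous f) (h : ∀ x, Complex.exp (f x) = g x) :
    logVariation g = f 1 - f 0 := by
  have hex : ∃ f : ℝ → ℂ, Continuous f ∧ ∀ x, Complex.exp (f x) = g x := ⟨f, hf, h⟩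
  rw [logVariation, dif_pos hex]
  exact sub_eq_sub_of_exp_eq hex.choose_spec.1 hf
    (fun x => (hex.choose_spec.2 x).trans (h x).symm) 1 0

theorem exp_logVariation {g : ℝ → ℂ} (hg : Continuous g) (h0 : ∀ x, g x ≠ 0) :
    Complex.exp (logVariation g) = g 1 / g 0 := by
  obtain ⟨f, hf, h⟩ := exists_continuous_log hg h0
  rw [logVariation_eq hf h, Complex.exp_sub, h, h]

theorem logVariation_neg {g : ℝ → ℂ} (hg : Continuous g) (h0 : ∀ x, g x ≠ 0) :
    logVariation (fun x => -g x) = logVariation g := by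
  obtain ⟨f, hf, h⟩ := exists_continuous_log hg h0
  rw [logVariation_eq hf h, logVariation_eq (f := fun x => f x + Real.pi * Complex.I)
    (by fun_prop) (fun x => by simp [Complex.exp_add, h])]
  ring

/-- For two disjoint curves, the variation of `log (δ t - γ s)` around the boundary of the
parameter square vanishes. -/
theorem logVariation_square {γ δ : ℝ → ℂ} (hγ : Continuous γ) (hδ : Continuous δ)
    (h : ∀ s t, δ t ≠ γ s) :
    logVariation (fun s => δ 0 - γ s) + logVariation (fun t => γ 1 - δ t) =
      logVariation (fun t => γ 0 - δ t) + logVariation (fun s => δ 1 - γ s) := by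
  obtain ⟨f, hf, hexp⟩ := exists_continuous_log (A := ℝ × ℝ) (g := fun p => δ p.2 - γ p.1)
    (by fun_prop) (fun p => sub_ne_zero.2 (h _ _))
  have hneg : ∀ s, logVariation (fun t => γ s - δ t) = f (s, 1) - f (s, 0) := fun s => by
    rw [← logVariation_eq (g := fun t => δ t - γ s) (f := fun t => f (s, t)) (by fun_prop)
      (fun t => hexp (s, t)),
      ← logVariation_neg (g := fun t => δ t - γ s) (by fun_prop) (fun t => sub_ne_zero.2 (h _ _))]
    simp
  have hpos : ∀ t, logVariation (fun s => δ t - γ s) = f (1, t) - f (0, t) := fun t =>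
    logVariation_eq (f := fun s => f (s, t)) (by fun_prop) (fun s => hexp (s, t))
  rw [hneg, hneg, hpos, hpos]
  ring

/-! ### Almost drawings of graphs in the plane -/

/-- A drawing of `K` in which vertex-disjoint edges are drawn inside disjoint sets. -/
structure AlmostDrawing {ι : Type} (K : SimpleGraph ι) where
  pt : ι → ℝ × ℝ
  pt_inj : Function.Injective pt
  region : ι → ι → Set (ℝ × ℝ)
  joined : ∀ i j, K.Adj i j → JoinedIn (region i j) (pt i) (pt j)
  disj : ∀ i j k l, K.Adj i j → K.Adj k l → i ≠ k → i ≠ l → j ≠ k → j ≠ l →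
    Disjoint (region i j) (region k l)

/-- The sign used to choose compatible logarithms of `P i - P j` and `P j - P i`. -/
def orderSign {N : ℕ} (i j : Fin N) : ℤ := if i < j then 1 else -1

theorem exists_log_differences {N : ℕ} {P : Fin N → ℂ} (hP : Function.Injective P) :
    ∃ ℓ : Fin N → Fin N → ℂ, (∀ i j, i ≠ j → Complex.exp (ℓ i j) = P i - P j) ∧
      ∀ i j, i ≠ j → ℓ i j - ℓ j i = orderSign i j * (Real.pi * Complex.I) := by
  refine ⟨fun i j => if i < j then Complex.log (P i - P j) else
    Complex.log (P j - P i) - Real.pi * Complex.I, fun i j hij => ?_, fun i j hij => ?_⟩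
  · have h1 : P i - P j ≠ 0 := sub_ne_zero.2 (hP.ne hij)
    have h2 : P j - P i ≠ 0 := sub_ne_zero.2 (hP.ne hij.symm)
    dsimp only
    split_ifs
    · rw [Complex.exp_log h1]
    · rw [Complex.exp_sub, Complex.exp_log h2, Complex.exp_pi_mul_I]
      ring
  · rcases lt_or_gt_of_ne hij with h | h
    · simp [orderSign, h, h.not_gt]
    · simp [orderSign, h, h.not_gt]

theorem AlmostDrawing.exists_winding {N : ℕ} {K : SimpleGraph (Fin N)} (D : AlmostDrawing K) :
    ∃ n : Fin N → Fin N → Fin N → ℤ, ∀ a b c d, K.Adj a b → K.Adj c d →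
      a ≠ c → a ≠ d → b ≠ c → b ≠ d →
      2 * (n c a b + n b c d - n a c d - n d a b) =
        -(orderSign c b + orderSign a c + orderSign b d + orderSign d a) := by
  classical
  set φ := Complex.equivRealProdCLM.symm with hφ
  let P : Fin N → ℂ := fun i => φ (D.pt i)
  have hP : Function.Injective P := φ.injective.comp D.pt_inj
  obtain ⟨ℓ, hℓ, hℓs⟩ := exists_log_differences hP
  have hg : ∀ i j, ∃ g : ℝ → ℂ, K.Adj i j → Continuous g ∧ g 0 = P i ∧ g 1 = P j ∧
      ∀ t, φ.symm (g t) ∈ D.region i j := fun i j => by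
    by_cases h : K.Adj i j
    · obtain ⟨γ, hγ⟩ := D.joined i j h
      refine ⟨fun t => φ (γ.extend t), fun _ => ⟨by fun_prop, by simp [P], by simp [P],
        fun t => ?_⟩⟩
      simp only [ContinuousLinearEquiv.symm_apply_apply]
      exact hγ _
    · exact ⟨0, fun h' => absurd h' h⟩
  choose g hg using hg
  have hdisj : ∀ a b c d, K.Adj a b → K.Adj c d → a ≠ c → a ≠ d → b ≠ c → b ≠ d →
      ∀ s t, g c d t ≠ g a b s := fun a b c d hab hcd h1 h2 h3 h4 s t heq =>
    Set.disjoint_left.1 (D.disj a b c d hab hcd h1 h2 h3 h4) ((hg a b hab).2.2.2 s)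
      (heq ▸ (hg c d hcd).2.2.2 t)
  have hn : ∀ c a b, ∃ n : ℤ, K.Adj a b → c ≠ a → c ≠ b → (∀ s, P c ≠ g a b s) →
      logVariation (fun s => P c - g a b s) =
        ℓ c b - ℓ c a + n * (2 * Real.pi * Complex.I) := fun c a b => by
    by_cases h : K.Adj a b ∧ c ≠ a ∧ c ≠ b ∧ (∀ s, P c ≠ g a b s)
    · obtain ⟨hab, hca, hcb, hne⟩ := h
      obtain ⟨hc, h0, h1, -⟩ := hg a b hab
      have : Complex.exp (logVariation (fun s => P c - g a b s)) =
          Complex.exp (ℓ c b - ℓ c a) := by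
        rw [exp_logVariation (by fun_prop) (fun s => sub_ne_zero.2 (hne s)), Complex.exp_sub,
          hℓ _ _ hcb, hℓ _ _ hca, h0, h1]
      obtain ⟨n, hn⟩ := Complex.exp_eq_exp_iff_exists_int.1 this
      exact ⟨n, fun _ _ _ _ => hn⟩
    · exact ⟨0, fun h1 h2 h3 h4 => absurd ⟨h1, h2, h3, h4⟩ h⟩
  choose n hn using hn
  refine ⟨n, fun a b c d hab hcd hac had hbc hbd => ?_⟩
  obtain ⟨cab, ab0, ab1, -⟩ := hg a b hab
  obtain ⟨ccd, cd0, cd1, -⟩ := hg c d hcd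
  have hd := hdisj a b c d hab hcd hac had hbc hbd
  have key := logVariation_square cab ccd hd
  rw [ab0, ab1, cd0, cd1, hn c a b hab hac.symm hbc.symm (fun s => cd0 ▸ hd s 0),
    hn d a b hab had.symm hbd.symm (fun s => cd1 ▸ hd s 1),
    hn a c d hcd hac had (fun s => ab0 ▸ (hd 0 s).symm),
    hn b c d hcd hbc hbd (fun s => ab1 ▸ (hd 1 s).symm)] at key
  have e1 := hℓs c b hbc.symm
  have e2 := hℓs a c hac
  have e3 := hℓs b d hbd
  have e4 := hℓs d a had.symm
  have hpi : (Real.pi * Complex.I : ℂ) ≠ 0 := by simp [Real.pi_ne_zero]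
  have : (Real.pi * Complex.I : ℂ) * ((2 * (n c a b + n b c d - n a c d - n d a b) : ℤ) : ℂ) =
      (Real.pi * Complex.I : ℂ) *
      ((-(orderSign c b + orderSign a c + orderSign b d + orderSign d a) : ℤ) : ℂ) := by
    push_cast
    linear_combination key - e1 - e2 - e3 - e4
  exact_mod_cast mul_left_cancel₀ hpi this

/-- The complete bipartite graph with sides `{0, 1, 2}` and `{3, 4, 5}`. -/
def K33 : SimpleGraph (Fin 6) where
  Adj i j := (i < 3 ∧ 3 ≤ j) ∨ (j < 3 ∧ 3 ≤ i)
  symm := ⟨fun _ _ h => h.symm⟩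
  loopless := ⟨fun _ h => by omega⟩

instance : DecidableRel K33.Adj := fun _ _ => inferInstanceAs (Decidable (_ ∨ _))

theorem AlmostDrawing.false_K5 (D : AlmostDrawing (⊤ : SimpleGraph (Fin 5))) : False := by
  obtain ⟨n, hn⟩ := D.exists_winding
  have h := fun a b c d (p : (⊤ : SimpleGraph (Fin 5)).Adj a b ∧
    (⊤ : SimpleGraph (Fin 5)).Adj c d ∧ a ≠ c ∧ a ≠ d ∧ b ≠ c ∧ b ≠ d) =>
    hn a b c d p.1 p.2.1 p.2.2.1 p.2.2.2.1 p.2.2.2.2.1 p.2.2.2.2.2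
  have h1 := h 0 1 2 3 (by decide)
  have h2 := h 0 1 2 4 (by decide)
  have h3 := h 0 1 3 4 (by decide)
  have h4 := h 0 2 1 3 (by decide)
  have h5 := h 0 2 1 4 (by decide)
  have h6 := h 0 2 3 4 (by decide)
  have h7 := h 0 3 1 2 (by decide)
  have h8 := h 0 3 1 4 (by decide)
  have h9 := h 0 3 2 4 (by decide)
  have h10 := h 0 4 1 2 (by decide)
  have h11 := h 0 4 1 3 (by decide)
  have h12 := h 0 4 2 3 (by decide)
  have h13 := h 1 2 3 4 (by decide)
  have h14 := h 1 3 2 4 (by decide)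
  have h15 := h 1 4 2 3 (by decide)
  clear hn h
  simp [orderSign] at *
  omega

theorem AlmostDrawing.false_K33 (D : AlmostDrawing K33) : False := by
  obtain ⟨n, hn⟩ := D.exists_winding
  have h := fun a b c d (p : K33.Adj a b ∧
    K33.Adj c d ∧ a ≠ c ∧ a ≠ d ∧ b ≠ c ∧ b ≠ d) =>
    hn a b c d p.1 p.2.1 p.2.2.1 p.2.2.2.1 p.2.2.2.2.1 p.2.2.2.2.2
  have h1 := h 0 3 1 4 (by decide)
  have h2 := h 0 3 1 5 (by decide)
  have h3 := h 0 4 1 3 (by decide)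
  have h4 := h 0 4 1 5 (by decide)
  have h5 := h 0 5 1 3 (by decide)
  have h6 := h 0 5 1 4 (by decide)
  have h7 := h 0 3 2 4 (by decide)
  have h8 := h 0 3 2 5 (by decide)
  have h9 := h 0 4 2 3 (by decide)
  have h10 := h 0 4 2 5 (by decide)
  have h11 := h 0 5 2 3 (by decide)
  have h12 := h 0 5 2 4 (by decide)
  have h13 := h 1 3 2 4 (by decide)
  have h14 := h 1 3 2 5 (by decide)
  have h15 := h 1 4 2 3 (by decide)
  have h16 := h 1 4 2 5 (by decide)
  have h17 := h 1 5 2 3 (by decide)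
  have h18 := h 1 5 2 4 (by decide)
  clear hn h
  simp [orderSign] at *
  omega

/-! ### Minor models give almost drawings -/

/-- A model of `K` as a minor of `G`. -/
structure MinorModel {ι V : Type} (K : SimpleGraph ι) (G : SimpleGraph V) where
  branch : ι → Set V
  conn : ∀ i, (G.induce (branch i)).Connected
  disj : ∀ i j, i ≠ j → Disjoint (branch i) (branch j)
  adj : ∀ i j, K.Adj i j → ∃ u ∈ branch i, ∃ v ∈ branch j, G.Adj u v

theorem connected_induce_image {V W : Type} {G : SimpleGraph V} {G' : SimpleGraph W} (f : G →g G')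
    {A : Set V} (hA : (G.induce A).Connected) : (G'.induce (f '' A)).Connected := by
  let g : G.induce A →g G'.induce (f '' A) :=
    ⟨fun x => ⟨f x, Set.mem_image_of_mem f x.2⟩, fun h => f.map_rel h⟩
  refine hA.map g ?_
  rintro ⟨_, x, hx, rfl⟩
  exact ⟨⟨x, hx⟩, rfl⟩

/-- Transport of a minor model along an injective homomorphism. -/
def MinorModel.map {ι V W : Type} {K : SimpleGraph ι} {G : SimpleGraph V} {G' : SimpleGraph W}
    (M : MinorModel K G) (f : G →g G') (hf : Function.Injective f) : MinorModel K G' where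
  branch i := f '' M.branch i
  conn i := connected_induce_image f (M.conn i)
  disj i j h := (Set.disjoint_image_iff hf).2 (M.disj i j h)
  adj i j h := by
    obtain ⟨u, hu, v, hv, huv⟩ := M.adj i j h
    exact ⟨f u, Set.mem_image_of_mem f hu, f v, Set.mem_image_of_mem f hv, f.map_rel huv⟩

/-- Restriction of an almost drawing along an injective homomorphism. -/
def AlmostDrawing.comap {ι κ : Type} {K : SimpleGraph ι} {K' : SimpleGraph κ}
    (D : AlmostDrawing K) (f : K' →g K) (hf : Function.Injective f) : AlmostDrawing K' where
  pt i := D.pt (f i)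
  pt_inj := D.pt_inj.comp hf
  region i j := D.region (f i) (f j)
  joined _ _ h := D.joined _ _ (f.map_rel h)
  disj _ _ _ _ h h' h1 h2 h3 h4 := D.disj _ _ _ _ (f.map_rel h) (f.map_rel h')
    (hf.ne h1) (hf.ne h2) (hf.ne h3) (hf.ne h4)

namespace PlaneEmbedding

variable {V : Type} {G : SimpleGraph V} (E : PlaneEmbedding G)

theorem vtx_mem_subSupport {S : Set V} {v : V} (hv : v ∈ S) : E.vtx v ∈ E.subSupport S :=
  Or.inl (Set.mem_image_of_mem _ hv)

theorem arc_subset_subSupport {S : Set V} {u v : V} (hu : u ∈ S) (hv : v ∈ S) (h : G.Adj u v) :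
    E.arc h ⊆ E.subSupport S := by
  intro p hp
  refine Or.inr ?_
  simp only [Set.mem_iUnion]
  exact ⟨u, hu, v, hv, h, hp⟩

theorem subSupport_mono {S T : Set V} (h : S ⊆ T) : E.subSupport S ⊆ E.subSupport T := by
  rintro p (⟨v, hv, rfl⟩ | hp)
  · exact E.vtx_mem_subSupport (h hv)
  · simp only [Set.mem_iUnion] at hp
    obtain ⟨u, hu, v, hv, huv, hp⟩ := hp
    exact E.arc_subset_subSupport (h hu) (h hv) huv hp

theorem subSupport_disjoint {S T : Set V} (h : Disjoint S T) :
    Disjoint (E.subSupport S) (E.subSupport T) := by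
  rw [Set.disjoint_left] at h ⊢
  rintro p (⟨v, hv, rfl⟩ | hp) (⟨w, hw, hwp⟩ | hq)
  · exact h hv (E.vtx_inj hwp ▸ hw)
  · simp only [Set.mem_iUnion] at hq
    obtain ⟨a, ha, b, hb, hab, hq⟩ := hq
    rcases E.arc_vtx hab v hq with rfl | rfl
    exacts [h hv ha, h hv hb]
  · simp only [Set.mem_iUnion] at hp
    obtain ⟨a, ha, b, hb, hab, hp⟩ := hp
    rw [← hwp] at hp
    rcases E.arc_vtx hab w hp with rfl | rfl
    exacts [h ha hw, h hb hw]
  · simp only [Set.mem_iUnion] at hp hq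
    obtain ⟨a, ha, b, hb, hab, hp⟩ := hp
    obtain ⟨c, hc, d, hd, hcd, hq⟩ := hq
    have hne : s(a, b) ≠ s(c, d) := by
      intro heq
      rcases Sym2.eq_iff.1 heq with ⟨rfl, rfl⟩ | ⟨rfl, rfl⟩
      exacts [h ha hc, h ha hd]
    obtain ⟨h1, h2⟩ := E.arc_inter hab hcd hne ⟨hp, hq⟩
    rcases h1 with rfl | h1
    · rcases h2 with h2 | h2
      · exact h ha (E.vtx_inj h2 ▸ hc)
      · exact h ha (E.vtx_inj h2 ▸ hd)
    · rw [Set.mem_singleton_iff] at h1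
      subst h1
      rcases h2 with h2 | h2
      · exact h hb (E.vtx_inj h2 ▸ hc)
      · exact h hb (E.vtx_inj h2 ▸ hd)

theorem joinedIn_arc {u v : V} (h : G.Adj u v) : JoinedIn (E.arc h) (E.vtx u) (E.vtx v) := by
  obtain ⟨γ, -, hγ⟩ := E.arc_path h
  exact ⟨γ, fun t => hγ ▸ Set.mem_range_self t⟩

theorem joinedIn_of_reachable {S : Set V} {x y : S} (h : (G.induce S).Reachable x y) :
    JoinedIn (E.subSupport S) (E.vtx x) (E.vtx y) := by
  obtain ⟨p⟩ := h
  induction p with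
  | nil => exact JoinedIn.refl (E.vtx_mem_subSupport (Subtype.property _))
  | cons hadj _ ih =>
    exact ((E.joinedIn_arc hadj).mono
      (E.arc_subset_subSupport (Subtype.property _) (Subtype.property _) hadj)).trans ih

theorem joinedIn_of_branches {A B : Set V} (hA : (G.induce A).Connected)
    (hB : (G.induce B).Connected) (h : ∃ u ∈ A, ∃ v ∈ B, G.Adj u v) {x y : V} (hx : x ∈ A)
    (hy : y ∈ B) : JoinedIn (E.subSupport (A ∪ B)) (E.vtx x) (E.vtx y) := by
  obtain ⟨u, hu, v, hv, huv⟩ := h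
  have h1 := (E.joinedIn_of_reachable (hA.preconnected ⟨x, hx⟩ ⟨u, hu⟩)).mono
    (E.subSupport_mono (Set.subset_union_left (t := B)))
  have h2 := (E.joinedIn_of_reachable (hB.preconnected ⟨v, hv⟩ ⟨y, hy⟩)).mono
    (E.subSupport_mono (Set.subset_union_right (s := A)))
  exact (h1.trans ((E.joinedIn_arc huv).mono
    (E.arc_subset_subSupport (Or.inl hu) (Or.inr hv) huv))).trans h2

theorem nonempty_almostDrawing (E : PlaneEmbedding G) {ι : Type} {K : SimpleGraph ι}
    (M : MinorModel K G) :
    Nonempty (AlmostDrawing K) := by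
  have hroot : ∀ i, ∃ v, v ∈ M.branch i := fun i => ⟨_, (M.conn i).nonempty.some.2⟩
  choose r hr using hroot
  refine ⟨⟨fun i => E.vtx (r i), ?_, fun i j => E.subSupport (M.branch i ∪ M.branch j), ?_, ?_⟩⟩
  · refine E.vtx_inj.comp fun i j hij => ?_
    by_contra hne
    exact Set.disjoint_left.1 (M.disj i j hne) (hr i) (hij ▸ hr j)
  · exact fun i j h => E.joinedIn_of_branches (M.conn i) (M.conn j) (M.adj i j h) (hr i) (hr j)
  · intro i j k l _ _ h1 h2 h3 h4
    refine E.subSupport_disjoint ?_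
    simp only [Set.disjoint_union_left, Set.disjoint_union_right]
    exact ⟨⟨M.disj _ _ h1, M.disj _ _ h3⟩, M.disj _ _ h2, M.disj _ _ h4⟩

theorem isCompact_arc {u v : V} (h : G.Adj u v) : IsCompact (E.arc h) := by
  obtain ⟨γ, -, hγ⟩ := E.arc_path h
  exact hγ ▸ isCompact_range γ.continuous

theorem isCompact_subSupport [Finite V] (S : Set V) : IsCompact (E.subSupport S) := by
  refine IsCompact.union ((Set.toFinite _).isCompact) ?_
  exact isCompact_iUnion fun u => isCompact_iUnion fun _ => isCompact_iUnion fun v =>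
    isCompact_iUnion fun _ => isCompact_iUnion fun h => E.isCompact_arc h

end PlaneEmbedding

theorem isPathConnected_compl_closedBall {R : ℝ} (hR : 0 ≤ R) :
    IsPathConnected (Metric.closedBall (0 : ℝ × ℝ) R)ᶜ := by
  have hrank : 1 < Module.rank ℝ (ℝ × ℝ) := by
    rw [← Module.finrank_eq_rank]
    norm_cast
    simp
  have h0 := isPathConnected_compl_singleton_of_one_lt_rank hrank 0
  have himg : (fun x : ℝ × ℝ => (1 + R / ‖x‖) • x) '' {0}ᶜ =
      (Metric.closedBall (0 : ℝ × ℝ) R)ᶜ := by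
    ext y
    simp only [Set.mem_image, Set.mem_compl_iff, Set.mem_singleton_iff, Metric.mem_closedBall,
      dist_zero_right, not_le]
    constructor
    · rintro ⟨x, hx, rfl⟩
      have hx' : 0 < ‖x‖ := norm_pos_iff.2 hx
      rw [norm_smul, Real.norm_of_nonneg (by positivity), add_mul, div_mul_cancel₀ _ hx'.ne']
      linarith
    · intro hy
      have hy0 : 0 < ‖y‖ := hR.trans_lt hy
      have hd : 0 < ‖y‖ - R := by linarith
      have hc : 0 < 1 - R / ‖y‖ := by
        rw [sub_pos, div_lt_one hy0]; exact hy
      refine ⟨(1 - R / ‖y‖) • y, smul_ne_zero hc.ne' (norm_pos_iff.1 hy0), ?_⟩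
      rw [norm_smul, Real.norm_of_nonneg hc.le, smul_smul]
      have : (1 + R / ((1 - R / ‖y‖) * ‖y‖)) * (1 - R / ‖y‖) = 1 := by
        have e : (1 - R / ‖y‖) * ‖y‖ = ‖y‖ - R := by field_simp
        rw [e]
        field_simp
        ring
      rw [this, one_smul]
  rw [← himg]
  refine h0.image' ?_
  refine ContinuousOn.smul (continuousOn_const.add (continuousOn_const.div
    continuous_norm.continuousOn fun x hx => ?_)) continuousOn_id
  exact norm_ne_zero_iff.2 hx

namespace PlaneEmbedding

variable {V : Type} {G : SimpleGraph V}

theorem IsOuterplane.exists_apex [Finite V] {E : PlaneEmbedding G} (hE : E.IsOuterplane) :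
    ∃ q : ℝ × ℝ, q ∉ E.subSupport Set.univ ∧
      ∀ v, JoinedIn (E.subSupport {v}ᶜ)ᶜ (E.vtx v) q := by
  set K := E.subSupport Set.univ with hK
  have hKc : IsCompact K := E.isCompact_subSupport _
  obtain ⟨R, hR0, hR⟩ : ∃ R : ℝ, 0 ≤ R ∧ K ⊆ Metric.closedBall 0 R := by
    obtain ⟨R, hR⟩ := hKc.isBounded.subset_closedBall 0
    exact ⟨max R 0, le_max_right _ _, hR.trans
      (Metric.closedBall_subset_closedBall (le_max_left _ _))⟩
  have hext := isPathConnected_compl_closedBall hR0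
  obtain ⟨q, hq⟩ := hext.nonempty
  refine ⟨q, fun h => hq (hR h), fun v => ?_⟩
  have hU : IsOpen (E.subSupport {v}ᶜ)ᶜ := (E.isCompact_subSupport _).isClosed.isOpen_compl
  have hKU : Kᶜ ⊆ (E.subSupport {v}ᶜ)ᶜ :=
    Set.compl_subset_compl.2 (E.subSupport_mono (Set.subset_univ _))
  have hv : E.vtx v ∈ (E.subSupport {v}ᶜ)ᶜ := fun h =>
    Set.disjoint_left.1 (E.subSupport_disjoint disjoint_compl_right)
      (E.vtx_mem_subSupport (Set.mem_singleton v)) h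
  obtain ⟨r, hr, hball⟩ := Metric.isOpen_iff.1 hU _ hv
  obtain ⟨p, hp, hpK, hunb⟩ :
      ∃ p ∈ Metric.ball (E.vtx v) r, p ∉ K ∧
        ¬ Bornology.IsBounded (connectedComponentIn Kᶜ p) := by
    obtain ⟨p, hp, hd⟩ := Metric.mem_closure_iff.1 (hE v (Set.mem_univ v)) r hr
    exact ⟨p, by rwa [Metric.mem_ball, dist_comm], hp⟩
  have h1 : JoinedIn (E.subSupport {v}ᶜ)ᶜ (E.vtx v) p :=
    (((convex_ball (E.vtx v) r).isPathConnected ⟨_, Metric.mem_ball_self hr⟩).joinedIn _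
      (Metric.mem_ball_self hr) _ hp).mono hball
  obtain ⟨z, hz, hzR⟩ : ∃ z ∈ connectedComponentIn Kᶜ p, z ∉ Metric.closedBall (0 : ℝ × ℝ) R := by
    by_contra! hcon
    exact hunb (Metric.isBounded_closedBall.subset hcon)
  have hopen : IsOpen (connectedComponentIn Kᶜ p) :=
    hKc.isClosed.isOpen_compl.connectedComponentIn
  have hconn : IsPathConnected (connectedComponentIn Kᶜ p) :=
    (hopen.isConnected_iff_isPathConnected).1 (isConnected_connectedComponentIn_iff.2 hpK)
  have h2 : JoinedIn (E.subSupport {v}ᶜ)ᶜ p z :=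
    (hconn.joinedIn _ (mem_connectedComponentIn hpK) _ hz).mono
      ((connectedComponentIn_subset _ _).trans hKU)
  have h3 : JoinedIn (E.subSupport {v}ᶜ)ᶜ z q :=
    (hext.joinedIn _ hzR _ hq).mono ((Set.compl_subset_compl.2 hR).trans hKU)
  exact (h1.trans h2).trans h3

end PlaneEmbedding

/-- The cone over a graph: a new vertex `none` adjacent to all others. -/
def coneGraph {ι : Type} (K : SimpleGraph ι) : SimpleGraph (Option ι) where
  Adj
    | none, none => False
    | none, some _ => True
    | some _, none => True
    | some i, some j => K.Adj i j
  symm := ⟨by rintro (_ | i) (_ | j) h <;> simp_all [K.adj_comm]⟩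
  loopless := ⟨by rintro (_ | i) h <;> simp_all⟩

instance {ι : Type} (K : SimpleGraph ι) [DecidableRel K.Adj] : DecidableRel (coneGraph K).Adj
  | none, none => inferInstanceAs (Decidable False)
  | none, some _ => inferInstanceAs (Decidable True)
  | some _, none => inferInstanceAs (Decidable True)
  | some i, some j => inferInstanceAs (Decidable (K.Adj i j))

theorem IsOuterplanar.nonempty_almostDrawing_cone {V : Type} [Finite V] {G : SimpleGraph V}
    (hG : IsOuterplanar G) {ι : Type} {K : SimpleGraph ι} (M : MinorModel K G) :
    Nonempty (AlmostDrawing (coneGraph K)) := by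
  obtain ⟨E, hE⟩ := hG
  obtain ⟨q, hq, hjoin⟩ := hE.exists_apex
  have hroot : ∀ i, ∃ v, v ∈ M.branch i := fun i => ⟨_, (M.conn i).nonempty.some.2⟩
  choose r hr using hroot
  have hinj : Function.Injective fun i => E.vtx (r i) := E.vtx_inj.comp fun i j hij => by
    by_contra hne
    exact Set.disjoint_left.1 (M.disj i j hne) (hr i) (hij ▸ hr j)
  have hqv : ∀ v, q ≠ E.vtx v := fun v h => hq (h ▸ E.vtx_mem_subSupport (Set.mem_univ v))
  have hapex : ∀ i, JoinedIn (E.subSupport (M.branch i)ᶜ)ᶜ (E.vtx (r i)) q := fun i =>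
    (hjoin (r i)).mono (Set.compl_subset_compl.2 (E.subSupport_mono
      (Set.compl_subset_compl.2 (Set.singleton_subset_iff.2 (hr i)))))
  have hdisj : ∀ i k l, i ≠ k → i ≠ l → Disjoint (E.subSupport (M.branch i)ᶜ)ᶜ
      (E.subSupport (M.branch k ∪ M.branch l)) := fun i k l h1 h2 =>
    disjoint_compl_left.mono_right (E.subSupport_mono (Set.union_subset
      (M.disj _ _ h1).subset_compl_left (M.disj _ _ h2).subset_compl_left))
  refine ⟨⟨fun o => o.elim q fun i => E.vtx (r i), ?_, fun o o' => match o, o' with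
    | none, none => ∅
    | none, some i => (E.subSupport (M.branch i)ᶜ)ᶜ
    | some i, none => (E.subSupport (M.branch i)ᶜ)ᶜ
    | some i, some j => E.subSupport (M.branch i ∪ M.branch j), ?_, ?_⟩⟩
  · rintro (_ | i) (_ | j) h
    · rfl
    · exact absurd h (hqv _)
    · exact absurd h.symm (hqv _)
    · exact congrArg some (hinj h)
  · rintro (_ | i) (_ | j) h
    · exact h.elim
    · exact (hapex j).symm
    · exact hapex i
    · exact E.joinedIn_of_branches (M.conn i) (M.conn j) (M.adj i j h) (hr i) (hr j)
  · rintro (_ | i) (_ | j) (_ | k) (_ | l) hij hkl h1 h2 h3 h4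
    all_goals first
      | exact hij.elim
      | exact hkl.elim
      | exact absurd rfl h1
      | exact absurd rfl h2
      | exact absurd rfl h3
      | exact absurd rfl h4
      | skip
    · exact hdisj _ _ _ (by simpa using h3) (by simpa using h4)
    · exact hdisj _ _ _ (by simpa using h1) (by simpa using h2)
    · exact (hdisj _ _ _ (Ne.symm (by simpa using h2)) (Ne.symm (by simpa using h4))).symm
    · exact (hdisj _ _ _ (Ne.symm (by simpa using h1)) (Ne.symm (by simpa using h3))).symm
    · refine E.subSupport_disjoint ?_
      simp only [Set.disjoint_union_left, Set.disjoint_union_right]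
      exact ⟨⟨M.disj _ _ (by simpa using h1), M.disj _ _ (by simpa using h3)⟩,
        M.disj _ _ (by simpa using h2), M.disj _ _ (by simpa using h4)⟩

/-- The complete bipartite graph with sides `{0, 1}` and `{2, 3, 4}`. -/
def K23 : SimpleGraph (Fin 5) where
  Adj i j := (i < 2 ∧ 2 ≤ j) ∨ (j < 2 ∧ 2 ≤ i)
  symm := ⟨fun _ _ h => h.symm⟩
  loopless := ⟨fun _ h => by omega⟩

instance : DecidableRel K23.Adj := fun _ _ => inferInstanceAs (Decidable (_ ∨ _))

theorem IsPlanar.isEmpty_K5 {V : Type} {G : SimpleGraph V} (hG : IsPlanar G) :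
    IsEmpty (MinorModel (⊤ : SimpleGraph (Fin 5)) G) :=
  ⟨fun M => (hG.some.nonempty_almostDrawing M).some.false_K5⟩

theorem IsOuterplanar.isEmpty_K4 {V : Type} [Finite V] {G : SimpleGraph V}
    (hG : IsOuterplanar G) : IsEmpty (MinorModel (⊤ : SimpleGraph (Fin 4)) G) := by
  refine ⟨fun M => ?_⟩
  obtain ⟨D⟩ := hG.nonempty_almostDrawing_cone M
  let f : Fin 5 → Option (Fin 4) := Fin.cons none some
  have hf : Function.Injective f := by decide
  have hadj : ∀ i j, (⊤ : SimpleGraph (Fin 5)).Adj i j → (coneGraph ⊤).Adj (f i) (f j) := by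
    decide
  exact (D.comap ⟨f, fun h => hadj _ _ h⟩ hf).false_K5

theorem IsOuterplanar.isEmpty_K23 {V : Type} [Finite V] {G : SimpleGraph V}
    (hG : IsOuterplanar G) : IsEmpty (MinorModel K23 G) := by
  refine ⟨fun M => ?_⟩
  obtain ⟨D⟩ := hG.nonempty_almostDrawing_cone M
  let f : Fin 6 → Option (Fin 5) := ![some 0, some 1, none, some 2, some 3, some 4]
  have hf : Function.Injective f := by decide
  have hadj : ∀ i j, K33.Adj i j → (coneGraph K23).Adj (f i) (f j) := by decide
  exact (D.comap ⟨f, fun h => hadj _ _ h⟩ hf).false_K33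

/-! ### Elimination orderings exclude `K₄`-minors -/

theorem connected_induce_diff_singleton {V : Type} {G : SimpleGraph V} {A : Set V} {v : V}
    (hA : (G.induce A).Connected) (hne : (A \ {v}).Nonempty)
    (hcl : ∀ x ∈ A, ∀ y ∈ A, G.Adj v x → G.Adj v y → x ≠ y → G.Adj x y) :
    (G.induce (A \ {v})).Connected := by
  have key : ∀ x y : A, (G.induce A).Reachable x y → ∀ hy : y.1 ∈ A \ {v},
      (∀ hx : x.1 ∈ A \ {v}, (G.induce (A \ {v})).Reachable ⟨x, hx⟩ ⟨y, hy⟩) ∧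
      (x.1 = v → ∀ w, ∀ hw : w ∈ A \ {v}, G.Adj v w →
        (G.induce (A \ {v})).Reachable ⟨w, hw⟩ ⟨y, hy⟩) := by
    rintro x y ⟨p⟩ hy
    induction p with
    | nil => exact ⟨fun _ => SimpleGraph.Reachable.refl _, fun h => absurd h hy.2⟩
    | @cons x z y hadj _ ih =>
      obtain ⟨ih1, ih2⟩ := ih hy
      have hadj' : G.Adj x.1 z.1 := hadj
      by_cases hz : z.1 = v
      · refine ⟨fun hx => ih2 hz _ hx (hz ▸ hadj'.symm), fun hx => ?_⟩
        exact absurd (hx.trans hz.symm) hadj'.ne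
      · refine ⟨fun hx => ?_, fun hx w hw hvw => ?_⟩
        · have : (G.induce (A \ {v})).Adj ⟨x.1, hx⟩ ⟨z.1, z.2, hz⟩ := hadj'
          exact this.reachable.trans (ih1 _)
        · by_cases hwz : w = z.1
          · subst hwz
            exact ih1 hw
          · have : (G.induce (A \ {v})).Adj ⟨w, hw⟩ ⟨z.1, z.2, hz⟩ :=
              hcl w hw.1 z.1 z.2 hvw (hx ▸ hadj') hwz
            exact this.reachable.trans (ih1 _)
  have := hne.to_subtype
  exact ⟨fun x y => (key ⟨x, x.2.1⟩ ⟨y, y.2.1⟩ (hA.preconnected _ _) y.2).1 x.2⟩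

theorem exists_adj_of_connected_induce {V : Type} {G : SimpleGraph V} {A : Set V} {v : V}
    (hA : (G.induce A).Connected) (hv : v ∈ A) (hne : (A \ {v}).Nonempty) :
    ∃ w ∈ A \ {v}, G.Adj v w := by
  obtain ⟨y, hy⟩ := hne
  obtain ⟨p⟩ := hA.preconnected ⟨v, hv⟩ ⟨y, hy.1⟩
  cases p with
  | nil => exact absurd rfl hy.2
  | cons h _ => exact ⟨_, ⟨Subtype.property _, fun h' => G.ne_of_adj h (h'.symm)⟩, h⟩

/-- A finite graph with a perfect elimination ordering of width two is `K₄`-minor free. -/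
theorem k4MinorFree_of_elimination {V : Type} [Finite V] {G : SimpleGraph V} (r : V → ℕ)
    (hr : ∀ u v, G.Adj u v → r u ≠ r v)
    (hcl : ∀ v x y, G.Adj v x → G.Adj v y → r v < r x → r v < r y → x ≠ y → G.Adj x y)
    (hthree : ∀ v x y z, G.Adj v x → G.Adj v y → G.Adj v z → r v < r x → r v < r y → r v < r z →
      x ≠ y → x ≠ z → y ≠ z → False) : K4MinorFree G := by
  rintro ⟨B, -, hconn, hdisj, hadj⟩
  induction hn : ∑ i, (B i).ncard using Nat.strong_induction_on generalizing B with
  | _ n ih =>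
  subst hn
  have hnonempty : ∀ i, (B i).Nonempty := fun i => ⟨_, (hconn i).nonempty.some.2⟩
  obtain ⟨v, hvU, hmin⟩ := Set.exists_min_image (⋃ i, B i) r (Set.toFinite _)
    (Set.nonempty_iUnion.2 ⟨0, hnonempty 0⟩)
  obtain ⟨i, hvi⟩ := Set.mem_iUnion.1 hvU
  have hup : ∀ j, ∀ x ∈ B j, G.Adj v x → r v < r x := fun j x hx h =>
    lt_of_le_of_ne (hmin x (Set.mem_iUnion.2 ⟨j, hx⟩)) (hr _ _ h)
  have huniq : ∀ j, v ∈ B j → j = i := fun j hj => by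
    by_contra h
    exact Set.disjoint_left.1 (hdisj j i h) hj hvi
  by_cases hsing : (B i \ {v}).Nonempty
  · have hne' : ∀ j, (B j \ {v}).Nonempty := fun j => by
      by_cases hj : j = i
      · exact hj ▸ hsing
      · obtain ⟨x, hx⟩ := hnonempty j
        exact ⟨x, hx, fun h => hj (huniq j (h ▸ hx))⟩
    obtain ⟨u', hu', hvu'⟩ := exists_adj_of_connected_induce (hconn i) hvi hsing
    have hreplace : ∀ j k, j ≠ k → ∀ u ∈ B j, ∀ w ∈ B k, w ≠ v → G.Adj u w →
        ∃ u₁ ∈ B j \ {v}, G.Adj u₁ w := fun j k hjk u hu w hw hwv huw => by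
      by_cases huv : u = v
      · subst huv
        obtain rfl := huniq j hu
        have : u' ≠ w := fun h => Set.disjoint_left.1 (hdisj _ _ hjk) hu'.1 (h ▸ hw)
        exact ⟨u', hu', hcl u u' w hvu' huw (hup _ _ hu'.1 hvu') (hup _ _ hw huw) this⟩
      · exact ⟨u, ⟨hu, huv⟩, huw⟩
    refine ih (∑ j, (B j \ {v}).ncard) ?_ (fun j => B j \ {v}) (fun j => ?_)
      (fun j k hjk => (hdisj j k hjk).mono Set.sdiff_subset Set.sdiff_subset) (fun j k hjk => ?_) rfl
    · refine Finset.sum_lt_sum (fun j _ => Set.ncard_le_ncard Set.sdiff_subset (Set.toFinite _))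
        ⟨i, Finset.mem_univ i, ?_⟩
      exact Set.ncard_sdiff_singleton_lt_of_mem hvi (Set.toFinite _)
    · exact connected_induce_diff_singleton (hconn j) (hne' j) fun x hx y hy hvx hvy hxy =>
        hcl v x y hvx hvy (hup _ _ hx hvx) (hup _ _ hy hvy) hxy
    · obtain ⟨u, hu, w, hw, huw⟩ := hadj j k hjk
      by_cases hwv : w = v
      · have huv : u ≠ v := fun h => G.ne_of_adj huw (h.trans hwv.symm)
        obtain ⟨w₁, hw₁, h⟩ := hreplace k j hjk.symm w hw u hu huv huw.symm
        exact ⟨u, ⟨hu, huv⟩, w₁, hw₁, h.symm⟩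
      · obtain ⟨u₁, hu₁, h⟩ := hreplace j k hjk u hu w hw hwv huw
        exact ⟨u₁, hu₁, w, ⟨hw, hwv⟩, h⟩
  · have hB : ∀ u ∈ B i, u = v := fun u hu => by
      by_contra h
      exact hsing ⟨u, hu, h⟩
    have hnb : ∀ j, i ≠ j → ∃ w ∈ B j, G.Adj v w := fun j hij => by
      obtain ⟨u, hu, w, hw, huw⟩ := hadj i j hij
      exact ⟨w, hw, hB u hu ▸ huw⟩
    obtain ⟨j, k, l, hj, hk, hl, hjk, hjl, hkl⟩ : ∃ j k l : Fin 4, i ≠ j ∧ i ≠ k ∧ i ≠ l ∧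
        j ≠ k ∧ j ≠ l ∧ k ≠ l := by
      clear * - i
      revert i
      decide
    obtain ⟨x, hx, hvx⟩ := hnb j hj
    obtain ⟨y, hy, hvy⟩ := hnb k hk
    obtain ⟨z, hz, hvz⟩ := hnb l hl
    have hd : ∀ a b, a ≠ b → ∀ x ∈ B a, ∀ y ∈ B b, x ≠ y := fun a b hab x hx y hy h =>
      Set.disjoint_left.1 (hdisj a b hab) hx (h ▸ hy)
    exact hthree v x y z hvx hvy hvz (hup _ _ hx hvx) (hup _ _ hy hvy) (hup _ _ hz hvz)
      (hd _ _ hjk _ hx _ hy) (hd _ _ hjl _ hx _ hz) (hd _ _ hkl _ hy _ hz)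

/-! ### The tower of gadgets -/

/-- The edges of one period of the tower. The vertices `0, …, 15` are those of the gadget,
`16` and `17` are the two hubs, and `18` is the vertex `0` of the next gadget. -/
def periodEdges : List (Fin 19 × Fin 19) :=
  [(0, 1), (0, 4), (0, 5), (0, 8), (0, 14), (0, 15), (1, 4), (1, 7), (1, 8), (1, 15), (2, 6),
    (2, 11), (2, 12), (2, 13), (2, 15), (3, 4), (3, 5), (3, 9), (4, 5), (4, 8), (4, 9), (5, 8),
    (5, 9), (6, 7), (6, 10), (6, 12), (6, 15), (7, 8), (7, 10), (7, 11), (7, 14), (7, 15),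
    (8, 9), (8, 14), (10, 11), (10, 12), (10, 13), (11, 13), (11, 14), (11, 15), (12, 13),
    (14, 15), (0, 16), (15, 16), (0, 17), (14, 17), (15, 17), (16, 17), (15, 18)]

/-- The graph formed by one period of the tower. -/
def periodGraph : SimpleGraph (Fin 19) where
  Adj x y := (x, y) ∈ periodEdges ∨ (y, x) ∈ periodEdges
  symm := ⟨fun _ _ h => h.symm⟩
  loopless := ⟨by decide +kernel⟩

instance : DecidableRel periodGraph.Adj := fun _ _ => inferInstanceAs (Decidable (_ ∨ _))

/-- The inclusion of the gadget into a period. -/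
def gadgetIncl (x : Fin 16) : Fin 19 := x.castLE (by decide)

/-- The 16-vertex gadget. -/
def gadget : SimpleGraph (Fin 16) := periodGraph.comap gadgetIncl

instance : DecidableRel gadget.Adj := fun x y =>
  inferInstanceAs (Decidable (periodGraph.Adj (gadgetIncl x) (gadgetIncl y)))

/-- The vertices of the infinite tower: two hubs and a gadget at each level. -/
abbrev TowerVertex := Fin 2 ⊕ ℕ × Fin 16

/-- Adjacency between a hub and a vertex of a gadget. -/
def HubAdj (h : Fin 2) (x : Fin 16) : Prop := x = 0 ∨ x = 15 ∨ (h = 1 ∧ x = 14)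

/-- The infinite tower: gadgets stacked between two adjacent hubs, where the vertex `15` of each
gadget is joined to the vertex `0` of the next one. -/
def tower : SimpleGraph TowerVertex where
  Adj
    | .inl h, .inl h' => h ≠ h'
    | .inl h, .inr (_, x) => HubAdj h x
    | .inr (_, x), .inl h => HubAdj h x
    | .inr (i, x), .inr (j, y) => (i = j ∧ gadget.Adj x y) ∨ (j = i + 1 ∧ x = 15 ∧ y = 0) ∨
        (i = j + 1 ∧ y = 15 ∧ x = 0)
  symm := ⟨by
    rintro (h | ⟨i, x⟩) (h' | ⟨j, y⟩) hadj
    · exact hadj.symm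
    · exact hadj
    · exact hadj
    · rcases hadj with ⟨h1, h2⟩ | h | h
      exacts [Or.inl ⟨h1.symm, h2.symm⟩, Or.inr (Or.inr h), Or.inr (Or.inl h)]⟩
  loopless := ⟨by
    rintro (h | ⟨i, x⟩) hadj
    · exact hadj rfl
    · rcases hadj with ⟨-, h⟩ | ⟨h, -⟩ | ⟨h, -⟩
      · exact gadget.loopless.irrefl x h
      all_goals omega⟩

/-- The inclusion of a period into the tower. -/
def periodIncl (i : ℕ) (w : Fin 19) : TowerVertex :=
  if h : (w : ℕ) < 16 then .inr (i, ⟨w, h⟩) else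
    if w = 16 then .inl 0 else if w = 17 then .inl 1 else .inr (i + 1, 0)

theorem periodIncl_gadgetIncl (i : ℕ) (x : Fin 16) :
    periodIncl i (gadgetIncl x) = .inr (i, x) := by
  simp [periodIncl, gadgetIncl]

theorem exists_period_of_tower_adj {u v : TowerVertex} (h : tower.Adj u v) :
    ∃ i, ∃ e ∈ periodEdges, (periodIncl i e.1 = u ∧ periodIncl i e.2 = v) ∨
      (periodIncl i e.1 = v ∧ periodIncl i e.2 = u) := by
  have hub : ∀ h i x, HubAdj h x → ∃ e ∈ periodEdges,
      periodIncl i e.1 = .inr (i, x) ∧ periodIncl i e.2 = .inl h := by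
    rintro h i x (rfl | rfl | ⟨rfl, rfl⟩)
    · fin_cases h
      · exact ⟨(0, 16), by decide, rfl, rfl⟩
      · exact ⟨(0, 17), by decide, rfl, rfl⟩
    · fin_cases h
      · exact ⟨(15, 16), by decide, rfl, rfl⟩
      · exact ⟨(15, 17), by decide, rfl, rfl⟩
    · exact ⟨(14, 17), by decide, rfl, rfl⟩
  rcases u with h₁ | ⟨i, x⟩ <;> rcases v with h₂ | ⟨j, y⟩
  · refine ⟨0, (16, 17), by decide, ?_⟩
    have : h₁ ≠ h₂ := h
    fin_cases h₁ <;> fin_cases h₂ <;> simp_all [periodIncl]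
  · obtain ⟨e, he, h1, h2⟩ := hub h₁ j y h
    exact ⟨j, e, he, Or.inr ⟨h1, h2⟩⟩
  · obtain ⟨e, he, h1, h2⟩ := hub h₂ i x h
    exact ⟨i, e, he, Or.inl ⟨h1, h2⟩⟩
  · rcases h with ⟨rfl, h | h⟩ | ⟨rfl, rfl, rfl⟩ | ⟨rfl, rfl, rfl⟩
    · exact ⟨i, _, h, Or.inl ⟨periodIncl_gadgetIncl i x, periodIncl_gadgetIncl i y⟩⟩
    · exact ⟨i, _, h, Or.inr ⟨periodIncl_gadgetIncl i y, periodIncl_gadgetIncl i x⟩⟩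
    · exact ⟨i, (15, 18), by decide, Or.inl ⟨rfl, rfl⟩⟩
    · exact ⟨j, (15, 18), by decide, Or.inr ⟨rfl, rfl⟩⟩

theorem exists_tower_adj (u : TowerVertex) : ∃ v, tower.Adj u v := by
  rcases u with h | ⟨i, x⟩
  · exact ⟨.inr (0, 0), Or.inl rfl⟩
  · obtain ⟨y, hy⟩ : ∃ y, gadget.Adj x y :=
      (by decide +kernel : ∀ x, ∃ y, gadget.Adj x y) x
    exact ⟨.inr (i, y), Or.inl ⟨rfl, hy⟩⟩

/-! ### Straight-line drawings -/

/-- The signed area spanned by three points. -/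
def orientation {R : Type} [CommRing R] (p q r : R × R) : R :=
  (q.1 - p.1) * (r.2 - p.2) - (q.2 - p.2) * (r.1 - p.1)

theorem exists_of_mem_segment {p q x : ℝ × ℝ} (h : x ∈ segment ℝ p q) :
    ∃ t, 0 ≤ t ∧ t ≤ 1 ∧ x.1 = (1 - t) * p.1 + t * q.1 ∧ x.2 = (1 - t) * p.2 + t * q.2 := by
  obtain ⟨s, t, hs, ht, hst, rfl⟩ := h
  obtain rfl : s = 1 - t := by linarith
  exact ⟨t, ht, by linarith, by simp, by simp⟩

/-- If a segment lies strictly on one side of a line, it misses all segments of this line. -/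
theorem segment_disjoint_of_orientation {p q r s x : ℝ × ℝ}
    (h : 0 < orientation p q r * orientation p q s) (hx : x ∈ segment ℝ p q)
    (hx' : x ∈ segment ℝ r s) : False := by
  obtain ⟨t, ht0, ht1, h1, h2⟩ := exists_of_mem_segment hx
  obtain ⟨t', ht0', ht1', h1', h2'⟩ := exists_of_mem_segment hx'
  have hz : orientation p q x = 0 := by
    simp only [orientation, h1, h2]; ring
  have hz' : orientation p q x = (1 - t') * orientation p q r + t' * orientation p q s := by
    simp only [orientation, h1', h2']; ring
  rw [hz] at hz'
  rcases pos_and_pos_or_neg_and_neg_of_mul_pos h with ⟨ha, hb⟩ | ⟨ha, hb⟩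
  · rcases ht0'.eq_or_lt with rfl | hpos
    · linarith
    · linarith [mul_pos hpos hb, mul_nonneg (sub_nonneg.2 ht1') ha.le]
  · rcases ht0'.eq_or_lt with rfl | hpos
    · linarith
    · linarith [mul_neg_of_pos_of_neg hpos hb,
        mul_nonpos_of_nonneg_of_nonpos (sub_nonneg.2 ht1') ha.le]

theorem eq_of_mem_segments_of_orientation {w p q x : ℝ × ℝ} (h : orientation w p q ≠ 0)
    (hx : x ∈ segment ℝ w p) (hx' : x ∈ segment ℝ w q) : x = w := by
  obtain ⟨t, ht0, ht1, h1, h2⟩ := exists_of_mem_segment hx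
  obtain ⟨t', ht0', ht1', h1', h2'⟩ := exists_of_mem_segment hx'
  have hz : orientation w p x = 0 := by
    simp only [orientation, h1, h2]; ring
  have hz' : orientation w p x = t' * orientation w p q := by
    simp only [orientation, h1', h2']; ring
  rw [hz] at hz'
  have ht : t' = 0 := by
    rcases mul_eq_zero.1 hz'.symm with h' | h'
    exacts [h', absurd h' h]
  ext
  · rw [h1', ht]; ring
  · rw [h2', ht]; ring

/-- A straight-line drawing without isolated vertices is a plane embedding. -/
noncomputable def PlaneEmbedding.ofSegments {V : Type} {G : SimpleGraph V} (pos : V → ℝ × ℝ)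
    (hpos : Function.Injective pos) (hex : ∀ u, ∃ v, G.Adj u v)
    (hinter : ∀ ⦃u v a b : V⦄, G.Adj u v → G.Adj a b → s(u, v) ≠ s(a, b) →
      segment ℝ (pos u) (pos v) ∩ segment ℝ (pos a) (pos b) ⊆
        ({pos u, pos v} : Set (ℝ × ℝ)) ∩ {pos a, pos b}) : PlaneEmbedding G where
  vtx := pos
  vtx_inj := hpos
  arc u v _ := segment ℝ (pos u) (pos v)
  arc_symm u v _ := segment_symm ℝ _ _
  arc_path u v h := by
    have hne : pos u ≠ pos v := hpos.ne h.ne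
    refine ⟨⟨⟨fun t => AffineMap.lineMap (pos u) (pos v) (t : ℝ), by fun_prop⟩, by simp, by simp⟩,
      fun s t hst => ?_, ?_⟩
    · exact Subtype.ext (AffineMap.lineMap_injective ℝ hne hst)
    · rw [segment_eq_image_lineMap]
      ext x
      simp
  arc_vtx u v h w hw := by
    by_contra hcon
    push Not at hcon
    obtain ⟨w', hw'⟩ := hex w
    have hne : s(u, v) ≠ s(w, w') := fun heq => by
      rcases Sym2.eq_iff.1 heq with ⟨h1, -⟩ | ⟨-, h1⟩
      exacts [hcon.1 h1.symm, hcon.2 h1.symm]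
    rcases (hinter h hw' hne ⟨hw, left_mem_segment ℝ _ _⟩).1 with h1 | h1
    exacts [hcon.1 (hpos h1), hcon.2 (hpos h1)]
  arc_inter _ _ _ _ h₁ h₂ hne := hinter h₁ h₂ hne

/-- Pullback of a plane embedding to a subgraph. -/
def PlaneEmbedding.comap {V W : Type} {G : SimpleGraph V} {G' : SimpleGraph W}
    (E : PlaneEmbedding G') (f : G →g G') (hf : Function.Injective f) : PlaneEmbedding G where
  vtx v := E.vtx (f v)
  vtx_inj := E.vtx_inj.comp hf
  arc _ _ h := E.arc (f.map_rel h)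
  arc_symm _ _ h := E.arc_symm (f.map_rel h)
  arc_path _ _ h := E.arc_path (f.map_rel h)
  arc_vtx _ _ h w hw := (E.arc_vtx (f.map_rel h) (f w) hw).imp (fun h => hf h) (fun h => hf h)
  arc_inter u v a b h₁ h₂ hne := E.arc_inter (f.map_rel h₁) (f.map_rel h₂) fun heq =>
    hne (Sym2.map.injective hf (by simpa using heq))

/-! ### A straight-line drawing of the tower -/

/-- The integer coordinates of the vertices of the bottom period. -/
def periodCoord : Fin 19 → ℤ × ℤ :=
  ![(0, 24), (3, 35), (9, 42), (7, 33), (3, 34), (8, 31), (8, 41), (11, 36), (13, 35), (8, 33),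
    (10, 38), (16, 38), (9, 41), (11, 40), (24, 36), (-1, 48), (-5, 0), (100, 0), (0, 72)]

/-- Two edges of a period meet at most in a common endpoint, as certified by orientations. -/
def WellPlaced (e f : Fin 19 × Fin 19) : Prop :=
  let c := periodCoord
  0 < orientation (c e.1) (c e.2) (c f.1) * orientation (c e.1) (c e.2) (c f.2) ∨
  0 < orientation (c f.1) (c f.2) (c e.1) * orientation (c f.1) (c f.2) (c e.2) ∨
  (e.1 = f.1 ∧ orientation (c e.1) (c e.2) (c f.2) ≠ 0) ∨
  (e.1 = f.2 ∧ orientation (c e.1) (c e.2) (c f.1) ≠ 0) ∨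
  (e.2 = f.1 ∧ orientation (c e.2) (c e.1) (c f.2) ≠ 0) ∨
  (e.2 = f.2 ∧ orientation (c e.2) (c e.1) (c f.1) ≠ 0)

instance (e f : Fin 19 × Fin 19) : Decidable (WellPlaced e f) := by
  unfold WellPlaced; infer_instance

theorem wellPlaced_of_mem : ∀ e ∈ periodEdges, ∀ f ∈ periodEdges, e ≠ f → WellPlaced e f := by
  decide +kernel

/-- The position of a vertex of the bottom period after stretching to level `i`. -/
noncomputable def periodPos (i : ℕ) (w : Fin 19) : ℝ × ℝ :=
  ((periodCoord w).1, (periodCoord w).2 * 3 ^ i)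

/-- The positions of the vertices of the tower. -/
noncomputable def towerPos : TowerVertex → ℝ × ℝ
  | .inl h => if h = 0 then (-5, 0) else (100, 0)
  | .inr (i, x) => periodPos i (gadgetIncl x)

theorem towerPos_periodIncl (i : ℕ) (w : Fin 19) : towerPos (periodIncl i w) = periodPos i w := by
  unfold periodIncl
  split_ifs with h1 h2 h3
  · rfl
  · subst h2
    simp [towerPos, periodPos, periodCoord]
  · subst h3
    simp [towerPos, periodPos, periodCoord]
  · obtain rfl : w = 18 := by
      revert w; decide
    simp [towerPos, periodPos, periodCoord, gadgetIncl]
    ring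

theorem orientation_periodPos (i : ℕ) (a b c : Fin 19) :
    orientation (periodPos i a) (periodPos i b) (periodPos i c) =
      3 ^ i * (orientation (periodCoord a) (periodCoord b) (periodCoord c) : ℤ) := by
  simp only [orientation, periodPos]
  push_cast
  ring

theorem towerPos_injective : Function.Injective towerPos := by
  have hy : ∀ x, 24 ≤ (periodCoord (gadgetIncl x)).2 ∧ (periodCoord (gadgetIncl x)).2 ≤ 48 := by
    decide
  have hinj : ∀ x y, periodCoord (gadgetIncl x) = periodCoord (gadgetIncl y) → x = y := by
    decide +kernel
  have hlt : ∀ (i j : ℕ) (x y : Fin 16), i < j →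
      (periodPos i (gadgetIncl x)).2 < (periodPos j (gadgetIncl y)).2 := fun i j x y hij => by
    have h1 : ((periodCoord (gadgetIncl x)).2 : ℝ) ≤ 48 := by exact_mod_cast (hy x).2
    have h2 : (24 : ℝ) ≤ (periodCoord (gadgetIncl y)).2 := by exact_mod_cast (hy y).1
    have h3 : (3 : ℝ) ^ (i + 1) ≤ 3 ^ j := pow_le_pow_right₀ (by norm_num) hij
    have h4 : (0 : ℝ) < 3 ^ i := by positivity
    have h5 : (0 : ℝ) < 3 ^ j := by positivity
    rw [pow_succ] at h3
    simp only [periodPos]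
    nlinarith
  have hpos : ∀ i x, 0 < (periodPos i (gadgetIncl x)).2 := fun i x => by
    have : (24 : ℝ) ≤ (periodCoord (gadgetIncl x)).2 := by exact_mod_cast (hy x).1
    simp only [periodPos]
    positivity
  have hhub : ∀ h, (towerPos (.inl h)).2 = 0 := fun h => by
    simp only [towerPos]; split_ifs <;> rfl
  rintro (h | ⟨i, x⟩) (h' | ⟨j, y⟩) heq
  · fin_cases h <;> fin_cases h' <;> first
      | rfl
      | norm_num [towerPos] at heq
  · exact absurd ((congrArg Prod.snd heq).symm.trans (hhub h)) (hpos j y).ne'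
  · exact absurd ((congrArg Prod.snd heq).trans (hhub h')) (hpos i x).ne'
  · rcases lt_trichotomy i j with hij | rfl | hij
    · exact absurd (congrArg Prod.snd heq) (hlt i j x y hij).ne
    · have h3 : (3 : ℝ) ^ i ≠ 0 := by positivity
      simp only [towerPos, periodPos, Prod.mk.injEq, Int.cast_inj, mul_left_inj' h3] at heq
      rw [hinj x y (Prod.ext heq.1 heq.2)]
    · exact absurd (congrArg Prod.snd heq) (hlt j i y x hij).ne'

/-- The property that two segments meet only in common endpoints. -/
def MeetAtEnds (p q r s : ℝ × ℝ) : Prop :=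
  segment ℝ p q ∩ segment ℝ r s ⊆ ({p, q} : Set (ℝ × ℝ)) ∩ {r, s}

theorem MeetAtEnds.symm {p q r s : ℝ × ℝ} (h : MeetAtEnds p q r s) : MeetAtEnds r s p q :=
  fun _ hx => (h hx.symm).symm

theorem MeetAtEnds.swap_left {p q r s : ℝ × ℝ} (h : MeetAtEnds p q r s) :
    MeetAtEnds q p r s := by
  unfold MeetAtEnds at *
  rwa [segment_symm ℝ q p, Set.pair_comm q p]

theorem MeetAtEnds.swap_right {p q r s : ℝ × ℝ} (h : MeetAtEnds p q r s) :
    MeetAtEnds p q s r := h.symm.swap_left.symm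

theorem meetAtEnds_of_orientation {w p q : ℝ × ℝ} (h : orientation w p q ≠ 0) :
    MeetAtEnds w p w q := fun x hx => by
  rw [eq_of_mem_segments_of_orientation h hx.1 hx.2]
  simp

theorem meetAtEnds_same_period (i : ℕ) {e f : Fin 19 × Fin 19} (h : WellPlaced e f) :
    MeetAtEnds (periodPos i e.1) (periodPos i e.2) (periodPos i f.1) (periodPos i f.2) := by
  have h3 : (0 : ℝ) < 3 ^ i := by positivity
  have hsign : ∀ a b c d, 0 < orientation (periodCoord a) (periodCoord b) (periodCoord c) *
      orientation (periodCoord a) (periodCoord b) (periodCoord d) →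
      0 < orientation (periodPos i a) (periodPos i b) (periodPos i c) *
        orientation (periodPos i a) (periodPos i b) (periodPos i d) := fun a b c d h => by
    rw [orientation_periodPos, orientation_periodPos, mul_mul_mul_comm]
    refine mul_pos (by positivity) ?_
    exact_mod_cast h
  have hne : ∀ a b c, orientation (periodCoord a) (periodCoord b) (periodCoord c) ≠ 0 →
      orientation (periodPos i a) (periodPos i b) (periodPos i c) ≠ 0 := fun a b c h => by
    rw [orientation_periodPos]
    exact mul_ne_zero h3.ne' (by exact_mod_cast h)
  obtain ⟨e₁, e₂⟩ := e
  obtain ⟨f₁, f₂⟩ := f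
  rcases h with h | h | ⟨h, h'⟩ | ⟨h, h'⟩ | ⟨h, h'⟩ | ⟨h, h'⟩
  · exact fun x hx => (segment_disjoint_of_orientation (hsign _ _ _ _ h) hx.1 hx.2).elim
  · exact fun x hx => (segment_disjoint_of_orientation (hsign _ _ _ _ h) hx.2 hx.1).elim
  · dsimp only at h h' ⊢
    subst h
    exact meetAtEnds_of_orientation (hne _ _ _ h')
  · dsimp only at h h' ⊢
    subst h
    exact (meetAtEnds_of_orientation (hne _ _ _ h')).swap_right
  · dsimp only at h h' ⊢
    subst h
    exact (meetAtEnds_of_orientation (hne _ _ _ h')).swap_left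
  · dsimp only at h h' ⊢
    subst h
    exact (meetAtEnds_of_orientation (hne _ _ _ h')).swap_left.swap_right

/-- The affine functional vanishing on the line through `(0, h)` and `(-σ c, 0)`. -/
def sideFunctional {R : Type} [CommRing R] (c σ h : R) (p : R × R) : R :=
  h * (c + σ * p.1) - c * p.2

theorem eq_left_or_right_of_sideFunctional {c σ h : ℝ} {p q x : ℝ × ℝ}
    (hp : 0 ≤ sideFunctional c σ h p) (hq : 0 ≤ sideFunctional c σ h q)
    (hx : x ∈ segment ℝ p q) :
    0 ≤ sideFunctional c σ h x ∧ (sideFunctional c σ h x = 0 →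
      (x = p ∧ sideFunctional c σ h p = 0) ∨ (x = q ∧ sideFunctional c σ h q = 0) ∨
      (sideFunctional c σ h p = 0 ∧ sideFunctional c σ h q = 0)) := by
  obtain ⟨t, ht0, ht1, h1, h2⟩ := exists_of_mem_segment hx
  have hval : sideFunctional c σ h x =
      (1 - t) * sideFunctional c σ h p + t * sideFunctional c σ h q := by
    simp only [sideFunctional, h1, h2]; ring
  have e1 := mul_nonneg (sub_nonneg.2 ht1) hp
  have e2 := mul_nonneg ht0 hq
  refine ⟨by linarith, fun h0 => ?_⟩
  have z1 : (1 - t) * sideFunctional c σ h p = 0 := by linarith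
  have z2 : t * sideFunctional c σ h q = 0 := by linarith
  rcases mul_eq_zero.1 z1 with z3 | z3
  · right; left
    have ht : t = 1 := by linarith
    subst ht
    refine ⟨Prod.ext (by linarith) (by linarith), by linarith⟩
  · rcases mul_eq_zero.1 z2 with z4 | z4
    · left
      subst z4
      exact ⟨Prod.ext (by linarith) (by linarith), z3⟩
    · exact Or.inr (Or.inr ⟨z3, z4⟩)

theorem sideFunctional_neg {c σ h : ℝ} (p : ℝ × ℝ) :
    sideFunctional (-c) (-σ) h p = -sideFunctional c σ h p := by
  simp only [sideFunctional]; ring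

/-- Edges of different periods are separated by a line through a hub and the vertex `0` of the
higher gadget. -/
theorem meetAtEnds_of_separated {i j : ℕ} (hij : i < j) {c σ : ℤ} (hc : 0 < c) {hub : Fin 19}
    (hnonneg : ∀ w, 0 ≤ c + σ * (periodCoord w).1)
    (hlow : ∀ w, 0 ≤ sideFunctional c σ 72 (periodCoord w) ∧
      (sideFunctional c σ 72 (periodCoord w) = 0 → w = hub ∨ w = 18))
    (hhub : periodCoord hub = (-σ * c, 0))
    {e f : Fin 19 × Fin 19} (he : ¬ ((e.1 = hub ∨ e.1 = 18) ∧ (e.2 = hub ∨ e.2 = 18)))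
    (hf₁ : sideFunctional c σ 24 (periodCoord f.1) ≤ 0)
    (hf₂ : sideFunctional c σ 24 (periodCoord f.2) ≤ 0)
    (hf : sideFunctional c σ 24 (periodCoord f.1) = 0 →
      sideFunctional c σ 24 (periodCoord f.2) = 0 → f = (0, hub)) :
    MeetAtEnds (periodPos i e.1) (periodPos i e.2) (periodPos j f.1) (periodPos j f.2) := by
  set h : ℝ := 24 * 3 ^ j with hh
  have hi : (0 : ℝ) < 3 ^ i := by positivity
  have hj : (0 : ℝ) < 3 ^ j := by positivity
  have hij' : (3 : ℝ) ^ i * 3 ≤ 3 ^ j := by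
    rw [← pow_succ]
    exact pow_le_pow_right₀ (by norm_num) hij
  have hcR : (0 : ℝ) < c := by exact_mod_cast hc
  have hhigh : ∀ w, sideFunctional (c : ℝ) σ h (periodPos j w) =
      3 ^ j * (sideFunctional c σ 24 (periodCoord w) : ℤ) := fun w => by
    simp only [sideFunctional, periodPos, hh]; push_cast; ring
  have hlowR : ∀ w, 0 ≤ sideFunctional (c : ℝ) σ h (periodPos i w) ∧
      (sideFunctional (c : ℝ) σ h (periodPos i w) = 0 → w = hub ∨ w = 18) := fun w => by
    have h1 : (0 : ℝ) ≤ c + σ * (periodCoord w).1 := by exact_mod_cast hnonneg w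
    have h2 : (0 : ℝ) ≤ 3 ^ i * (sideFunctional c σ 72 (periodCoord w) : ℤ) :=
      mul_nonneg hi.le (by exact_mod_cast (hlow w).1)
    have h3 : (3 : ℝ) ^ i * (sideFunctional c σ 72 (periodCoord w) : ℤ) ≤
        sideFunctional (c : ℝ) σ h (periodPos i w) := by
      simp only [sideFunctional, periodPos, hh]; push_cast
      nlinarith [mul_le_mul_of_nonneg_right hij' h1]
    refine ⟨h2.trans h3, fun h0 => (hlow w).2 ?_⟩
    have : (3 : ℝ) ^ i * (sideFunctional c σ 72 (periodCoord w) : ℤ) = 0 :=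
      le_antisymm (h3.trans h0.le) h2
    exact_mod_cast (mul_eq_zero.1 this).resolve_left hi.ne'
  have hf₁' : sideFunctional (c : ℝ) σ h (periodPos j f.1) ≤ 0 := by
    rw [hhigh]; exact mul_nonpos_of_nonneg_of_nonpos hj.le (by exact_mod_cast hf₁)
  have hf₂' : sideFunctional (c : ℝ) σ h (periodPos j f.2) ≤ 0 := by
    rw [hhigh]; exact mul_nonpos_of_nonneg_of_nonpos hj.le (by exact_mod_cast hf₂)
  rintro x ⟨hxe, hxf⟩
  obtain ⟨hx0, hxe'⟩ := eq_left_or_right_of_sideFunctional (hlowR e.1).1 (hlowR e.2).1 hxe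
  have hf₁n : 0 ≤ sideFunctional (-c : ℝ) (-σ) h (periodPos j f.1) := by
    rw [sideFunctional_neg]; linarith
  have hf₂n : 0 ≤ sideFunctional (-c : ℝ) (-σ) h (periodPos j f.2) := by
    rw [sideFunctional_neg]; linarith
  obtain ⟨hx0', hxf'⟩ := eq_left_or_right_of_sideFunctional hf₁n hf₂n hxf
  simp only [sideFunctional_neg, neg_eq_zero] at hx0' hxf'
  have hxz : sideFunctional (c : ℝ) σ h x = 0 := by linarith
  have hend : ∃ w, x = periodPos i w ∧ sideFunctional (c : ℝ) σ h (periodPos i w) = 0 ∧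
      x ∈ ({periodPos i e.1, periodPos i e.2} : Set (ℝ × ℝ)) := by
    rcases hxe' hxz with ⟨h1, h2⟩ | ⟨h1, h2⟩ | ⟨h1, h2⟩
    · exact ⟨e.1, h1, h2, Or.inl h1⟩
    · exact ⟨e.2, h1, h2, Or.inr h1⟩
    · exact absurd ⟨(hlowR _).2 h1, (hlowR _).2 h2⟩ he
  obtain ⟨w, hxw, hw0, hmem⟩ := hend
  refine ⟨hmem, ?_⟩
  rcases hxf' hxz with ⟨h1, -⟩ | ⟨h1, -⟩ | ⟨h1, h2⟩
  · exact Or.inl h1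
  · exact Or.inr h1
  · rw [hhigh] at h1 h2
    have h1' := (mul_eq_zero.1 h1).resolve_left hj.ne'
    have h2' := (mul_eq_zero.1 h2).resolve_left hj.ne'
    obtain rfl := hf (by exact_mod_cast h1') (by exact_mod_cast h2')
    rcases (hlowR w).2 hw0 with rfl | rfl
    · right
      rw [hxw]
      simp [periodPos, hhub]
    · left
      rw [hxw]
      simp only [sideFunctional, periodPos, periodCoord, hh] at hw0 ⊢
      simp at hw0 ⊢
      have : (c : ℝ) * (24 * 3 ^ j - 72 * 3 ^ i) = 0 := by linarith
      have := (mul_eq_zero.1 this).resolve_left hcR.ne'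
      linarith

theorem meetAtEnds_periods {i j : ℕ} (hij : i < j) {e f : Fin 19 × Fin 19}
    (he : e ∈ periodEdges) (hf : f ∈ periodEdges) (he' : e ≠ (16, 17)) (hf' : f ≠ (16, 17)) :
    MeetAtEnds (periodPos i e.1) (periodPos i e.2) (periodPos j f.1) (periodPos j f.2) := by
  have hfin : ∀ f ∈ periodEdges, f ≠ (16, 17) →
      (sideFunctional 100 (-1) 24 (periodCoord f.1) ≤ 0 ∧
        sideFunctional 100 (-1) 24 (periodCoord f.2) ≤ 0 ∧
        (sideFunctional 100 (-1) 24 (periodCoord f.1) = 0 →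
          sideFunctional 100 (-1) 24 (periodCoord f.2) = 0 → f = (0, 17))) ∨
      (sideFunctional 5 1 24 (periodCoord f.1) ≤ 0 ∧
        sideFunctional 5 1 24 (periodCoord f.2) ≤ 0 ∧
        (sideFunctional 5 1 24 (periodCoord f.1) = 0 →
          sideFunctional 5 1 24 (periodCoord f.2) = 0 → f = (0, 16))) := by decide +kernel
  rcases hfin f hf hf' with ⟨h1, h2, h3⟩ | ⟨h1, h2, h3⟩
  · exact meetAtEnds_of_separated hij (by norm_num) (by decide +kernel) (by decide +kernel)
      (by decide +kernel) (by revert e; decide +kernel) h1 h2 h3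
  · exact meetAtEnds_of_separated hij (by norm_num) (by decide +kernel) (by decide +kernel)
      (by decide +kernel) (by revert e; decide +kernel) h1 h2 h3

theorem meetAtEnds_tower_periods (i j : ℕ) {e f : Fin 19 × Fin 19}
    (he : e ∈ periodEdges) (hf : f ∈ periodEdges)
    (hne : s(periodIncl i e.1, periodIncl i e.2) ≠ s(periodIncl j f.1, periodIncl j f.2)) :
    MeetAtEnds (periodPos i e.1) (periodPos i e.2) (periodPos j f.1) (periodPos j f.2) := by
  have hsame : ∀ l, ∀ e' ∈ periodEdges, ∀ f' ∈ periodEdges, e' ≠ f' →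
      MeetAtEnds (periodPos l e'.1) (periodPos l e'.2) (periodPos l f'.1) (periodPos l f'.2) :=
    fun l e' he' f' hf' h => meetAtEnds_same_period l (wellPlaced_of_mem e' he' f' hf' h)
  have hhub : ∀ i j, periodPos i 16 = periodPos j 16 ∧ periodPos i 17 = periodPos j 17 := by
    simp [periodPos, periodCoord]
  by_cases he' : e = (16, 17)
  · subst he'
    have hf' : ((16, 17) : Fin 19 × Fin 19) ≠ f := by
      rintro rfl
      exact hne rfl
    have := hsame j (16, 17) he f hf hf'
    dsimp only at this ⊢
    rwa [(hhub i j).1, (hhub i j).2]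
  by_cases hf' : f = (16, 17)
  · subst hf'
    have := hsame i e he (16, 17) hf he'
    dsimp only at this ⊢
    rwa [(hhub j i).1, (hhub j i).2]
  rcases lt_trichotomy i j with hij | rfl | hij
  · exact meetAtEnds_periods hij he hf he' hf'
  · exact hsame i e he f hf fun h => hne (h ▸ rfl)
  · exact (meetAtEnds_periods hij hf he hf' he').symm

/-- The straight-line drawing of the tower. -/
noncomputable def towerEmbedding : PlaneEmbedding tower := by
  refine PlaneEmbedding.ofSegments towerPos towerPos_injective exists_tower_adj ?_
  intro u v a b huv hab hne
  obtain ⟨i, e, he, heq⟩ := exists_period_of_tower_adj huv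
  obtain ⟨j, f, hf, hfeq⟩ := exists_period_of_tower_adj hab
  have key := fun h => meetAtEnds_tower_periods i j he hf h
  simp only [← towerPos_periodIncl] at key
  change MeetAtEnds _ _ _ _
  rcases heq with ⟨rfl, rfl⟩ | ⟨rfl, rfl⟩ <;> rcases hfeq with ⟨rfl, rfl⟩ | ⟨rfl, rfl⟩
  · exact key hne
  · exact (key (by rwa [Sym2.eq_swap (a := periodIncl j f.1)])).swap_right
  · exact (key (by rwa [Sym2.eq_swap (a := periodIncl i e.1)])).swap_left
  · exact (key (by rwa [Sym2.eq_swap (a := periodIncl i e.1),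
      Sym2.eq_swap (a := periodIncl j f.1)])).swap_left.swap_right

/-! ### Minor models given by lists -/

theorem connected_induce_union_of_adj {V : Type} {G : SimpleGraph V} {A B : Set V}
    (hA : (G.induce A).Connected) (hB : (G.induce B).Connected)
    (h : ∃ u ∈ A, ∃ v ∈ B, G.Adj u v) : (G.induce (A ∪ B)).Connected := by
  obtain ⟨u, hu, v, hv, huv⟩ := h
  have hAv : (G.induce (A ∪ {u, v})).Connected :=
    SimpleGraph.induce_union_connected hA.preconnected
      (SimpleGraph.induce_pair_connected_of_adj huv).preconnected ⟨u, hu, by simp⟩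
  have h := SimpleGraph.induce_union_connected hAv.preconnected hB.preconnected ⟨v, by simp, hv⟩
  have hAB : A ∪ {u, v} ∪ B = A ∪ B := by
    rw [Set.union_assoc, Set.insert_union, Set.singleton_union, Set.insert_eq_of_mem hv,
      Set.union_insert, Set.insert_eq_of_mem (Set.mem_union_left B hu)]
  rwa [hAB] at h

theorem connected_induce_singleton {V : Type} (G : SimpleGraph V) (v : V) :
    (G.induce {v}).Connected := by
  have : Nonempty ({v} : Set V) := ⟨⟨v, rfl⟩⟩
  exact ⟨fun x y => by rw [Subsingleton.elim x y]⟩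

/-- Every entry of the list except for the last one is adjacent to a later entry. -/
def ListConnected {V : Type} (G : SimpleGraph V) : List V → Prop
  | [] => False
  | [_] => True
  | a :: b :: l => (∃ c ∈ b :: l, G.Adj a c) ∧ ListConnected G (b :: l)

instance ListConnected.decidable {V : Type} (G : SimpleGraph V) [DecidableRel G.Adj] :
    ∀ l, Decidable (ListConnected G l)
  | [] => inferInstanceAs (Decidable False)
  | [_] => inferInstanceAs (Decidable True)
  | _ :: b :: l =>
    have := ListConnected.decidable G (b :: l)
    inferInstanceAs (Decidable (_ ∧ _))

theorem ListConnected.connected {V : Type} {G : SimpleGraph V} {l : List V}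
    (h : ListConnected G l) : (G.induce {x | x ∈ l}).Connected := by
  induction l with
  | nil => exact h.elim
  | cons a l ih =>
    cases l with
    | nil =>
      have : {x | x ∈ [a]} = ({a} : Set V) := by ext; simp
      rw [this]
      exact connected_induce_singleton G a
    | cons b l =>
      have : {x | x ∈ a :: b :: l} = ({a} : Set V) ∪ {x | x ∈ b :: l} := by ext; simp
      rw [this]
      obtain ⟨⟨c, hc, hac⟩, h⟩ := h
      exact connected_induce_union_of_adj (connected_induce_singleton G a) (ih h)
        ⟨a, rfl, c, hc, hac⟩

/-- The lists `B i` form a model of `K` as a minor of `G`, where the pairs `(i, j)` with `skip i j`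
need not be adjacent. -/
def IsListModel {ι V : Type} (K : SimpleGraph ι) (G : SimpleGraph V) (skip : ι → ι → Prop)
    (B : ι → List V) : Prop :=
  (∀ i, ListConnected G (B i)) ∧ (∀ i j, i ≠ j → ∀ x ∈ B i, x ∉ B j) ∧
    ∀ i j, K.Adj i j → skip i j ∨ ∃ u ∈ B i, ∃ v ∈ B j, G.Adj u v

instance {ι V : Type} [Fintype ι] [DecidableEq ι] [DecidableEq V] (K : SimpleGraph ι)
    [DecidableRel K.Adj] (G : SimpleGraph V) [DecidableRel G.Adj] (skip : ι → ι → Prop)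
    [DecidableRel skip] (B : ι → List V) : Decidable (IsListModel K G skip B) :=
  inferInstanceAs (Decidable (_ ∧ _ ∧ _))

/-- A list model in `G` is a minor model in any larger graph containing the skipped edges. -/
def IsListModel.toMinorModel {ι V : Type} {K : SimpleGraph ι} {G G' : SimpleGraph V}
    {skip : ι → ι → Prop} {B : ι → List V} (h : IsListModel K G skip B) (hG : G ≤ G')
    (hskip : ∀ i j, skip i j → ∃ u ∈ B i, ∃ v ∈ B j, G'.Adj u v) : MinorModel K G' where
  branch i := {x | x ∈ B i}
  conn i := (h.1 i).connected.mono fun _ _ h' => hG h'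
  disj i j hij := Set.disjoint_left.2 fun x hx hx' => h.2.1 i j hij x hx hx'
  adj i j hij := by
    rcases h.2.2 i j hij with h' | ⟨u, hu, v, hv, huv⟩
    exacts [hskip i j h', ⟨u, hu, v, hv, hG huv⟩]

/-- Restriction of a minor model to an induced subgraph containing its branch sets. -/
def MinorModel.restrict {ι V : Type} {K : SimpleGraph ι} {G : SimpleGraph V}
    (M : MinorModel K G) (A : Set V) (hA : ∀ i, M.branch i ⊆ A) :
    MinorModel K (G.induce A) where
  branch i := Subtype.val ⁻¹' M.branch i
  conn i := by
    let g : G.induce (M.branch i) →g (G.induce A).induce (Subtype.val ⁻¹' M.branch i) :=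
      ⟨fun x => ⟨⟨x, hA i x.2⟩, x.2⟩, fun h => h⟩
    refine (M.conn i).map g ?_
    rintro ⟨⟨x, hx⟩, hx'⟩
    exact ⟨⟨x, hx'⟩, rfl⟩
  disj i j h := (M.disj i j h).preimage _
  adj i j h := by
    obtain ⟨u, hu, v, hv, huv⟩ := M.adj i j h
    exact ⟨⟨u, hA i hu⟩, hu, ⟨v, hA j hv⟩, hv, huv⟩

/-! ### Outerplanar induced subgraphs of the gadget -/

/-- No set with at most `n` elements meets all the lists. -/
def NotHit {α : Type} [DecidableEq α] : ℕ → List (List α) → Prop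
  | _, [] => False
  | 0, _ :: _ => True
  | n + 1, l :: L => ∀ a ∈ l, NotHit n (L.filter (a ∉ ·))

instance NotHit.decidable {α : Type} [DecidableEq α] : ∀ n L, Decidable (NotHit (α := α) n L)
  | 0, [] => inferInstanceAs (Decidable False)
  | _ + 1, [] => inferInstanceAs (Decidable False)
  | 0, _ :: _ => inferInstanceAs (Decidable True)
  | n + 1, l :: L =>
    have := fun a : α => NotHit.decidable n (L.filter (a ∉ ·))
    inferInstanceAs (Decidable (∀ a ∈ l, NotHit n (L.filter (a ∉ ·))))

theorem NotHit.exists_avoiding {α : Type} [DecidableEq α] {n : ℕ} {L : List (List α)}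
    (h : NotHit n L) (T : Finset α) (hT : T.card ≤ n) : ∃ l ∈ L, ∀ x ∈ l, x ∉ T := by
  induction n generalizing L T with
  | zero =>
    cases L with
    | nil => exact h.elim
    | cons l L =>
      obtain rfl : T = ∅ := by simpa using hT
      exact ⟨l, by simp, by simp⟩
  | succ n ih =>
    cases L with
    | nil => exact h.elim
    | cons l L =>
      by_cases hl : ∀ x ∈ l, x ∉ T
      · exact ⟨l, by simp, hl⟩
      · push Not at hl
        obtain ⟨a, hal, haT⟩ := hl
        obtain ⟨l', hl', hav⟩ := ih (h a hal) (T.erase a) (by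
          rw [Finset.card_erase_of_mem haT]; omega)
        simp only [List.mem_filter, decide_eq_true_eq] at hl'
        refine ⟨l', List.mem_cons_of_mem _ hl'.1, fun x hx hxT => hav x hx ?_⟩
        exact Finset.mem_erase.2 ⟨fun hxa => hl'.2 (hxa ▸ hx), hxT⟩

/-- Branch sets of `K₄`-minors of the gadget. -/
def gadgetK4Models : List (Fin 4 → List (Fin 16)) :=
  [![[3], [4], [5], [9]], ![[0], [1], [4], [8]], ![[8, 0], [1], [7], [15]],
    ![[11, 2], [10], [12], [13]], ![[6, 2], [10], [12], [13]], ![[2], [10, 6], [11], [15]],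
    ![[6, 2], [7], [10], [11]], ![[1, 0], [7], [14], [15]], ![[8, 0], [7], [14], [15]],
    ![[8, 1], [7], [14], [15]], ![[11, 15, 6], [10], [12], [13]], ![[2], [11, 15, 6], [12], [13]],
    ![[11, 7, 6], [10], [12], [13]], ![[2], [11, 7, 6], [12], [13]]]

/-- Branch sets of a `K_{2,3}`-minor of the gadget. -/
def gadgetK23Model : Fin 5 → List (Fin 16) := ![[0], [8], [1], [5], [14]]

theorem isListModel_gadgetK4Models :
    ∀ B ∈ gadgetK4Models, IsListModel ⊤ gadget (fun _ _ => False) B := by decide +kernel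

theorem isListModel_gadgetK23Model :
    IsListModel K23 gadget (fun _ _ => False) gadgetK23Model := by decide +kernel

/-- The vertex set covered by a family of lists. -/
def listUnion {m : ℕ} {α : Type} (B : Fin m → List α) : List α := (List.finRange m).flatMap B

theorem mem_listUnion {m : ℕ} {α : Type} (B : Fin m → List α) {i : Fin m} {x : α} (h : x ∈ B i) :
    x ∈ listUnion B :=
  List.mem_flatMap.2 ⟨i, List.mem_finRange i, h⟩

theorem notHit_gadget :
    NotHit 4 (listUnion gadgetK23Model :: gadgetK4Models.map listUnion) := by decide +kernel

/-- An induced subgraph containing a gadget with at most four vertices removed is not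
outerplanar. -/
theorem five_le_card_of_isOuterplanar {V : Type} {G : SimpleGraph V} {S : Set V} [Finite S]
    (hS : IsOuterplanar (G.induce S)) (f : gadget →g G) (hf : Function.Injective f)
    (T : Finset (Fin 16)) (hT : ∀ x, x ∉ T → f x ∈ S) : 5 ≤ T.card := by
  by_contra hcard
  obtain ⟨l, hl, hav⟩ := notHit_gadget.exists_avoiding T (by omega)
  rcases List.mem_cons.1 hl with rfl | hl
  · let M := (isListModel_gadgetK23Model.toMinorModel le_rfl (fun _ _ h => h.elim)).map f hf
    refine hS.isEmpty_K23.elim (M.restrict S ?_)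
    rintro i _ ⟨x, hx, rfl⟩
    exact hT x (hav x (mem_listUnion _ hx))
  · obtain ⟨B, hB, rfl⟩ := List.mem_map.1 hl
    let M := ((isListModel_gadgetK4Models B hB).toMinorModel le_rfl (fun _ _ h => h.elim)).map f hf
    refine hS.isEmpty_K4.elim (M.restrict S ?_)
    rintro i _ ⟨x, hx, rfl⟩
    exact hT x (hav x (mem_listUnion _ hx))

/-! ### The finite towers -/

/-- The tower with `k` levels. -/
def finiteTower (k : ℕ) : SimpleGraph (Fin 2 ⊕ Fin k × Fin 16) :=
  tower.comap (Sum.map id (Prod.map Fin.val id))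

/-- A plane embedding of the tower with `k` levels. -/
noncomputable def finiteTowerEmbedding (k : ℕ) : PlaneEmbedding (finiteTower k) :=
  towerEmbedding.comap ⟨Sum.map id (Prod.map Fin.val id), fun h => h⟩
    (Function.injective_id.sumMap (Fin.val_injective.prodMap Function.injective_id))

/-- The gadget at level `i` of the tower. -/
def levelEmbedding {k : ℕ} (i : Fin k) : gadget ↪g finiteTower k where
  toFun x := .inr (i, x)
  inj' _ _ h := by simpa using h
  map_rel_iff' {x y} := by
    change (((i : ℕ) = i ∧ gadget.Adj x y) ∨ _ ∨ _) ↔ gadget.Adj x y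
    simp

/-! ### Edge-maximality: two vertices in a common level -/

/-- The two hubs together with the gadget at level `0`. -/
def blockGraph : SimpleGraph (Fin 2 ⊕ Fin 16) := tower.comap (Sum.map id (Prod.mk 0))

instance : DecidableRel blockGraph.Adj
  | .inl h, .inl h' => inferInstanceAs (Decidable (h ≠ h'))
  | .inl _, .inr _ => inferInstanceAs (Decidable (_ ∨ _ ∨ _ ∧ _))
  | .inr _, .inl _ => inferInstanceAs (Decidable (_ ∨ _ ∨ _ ∧ _))
  | .inr x, .inr y =>
    inferInstanceAs (Decidable (((0 : ℕ) = 0 ∧ gadget.Adj x y) ∨ (0 = 0 + 1 ∧ x = 15 ∧ y = 0) ∨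
      (0 = 0 + 1 ∧ y = 15 ∧ x = 0)))

/-- The two hubs together with the gadget at level `i`. -/
def blockEmbedding {k : ℕ} (i : Fin k) : blockGraph ↪g finiteTower k where
  toFun := Sum.map id (Prod.mk i)
  inj' := Function.injective_id.sumMap (Prod.mk_right_injective i)
  map_rel_iff' {u v} := by
    rcases u with h | x <;> rcases v with h' | y
    · rfl
    · rfl
    · rfl
    · change (((i : ℕ) = i ∧ gadget.Adj x y) ∨ (i = (i : ℕ) + 1 ∧ x = 15 ∧ y = 0) ∨
        (i = (i : ℕ) + 1 ∧ y = 15 ∧ x = 0)) ↔ (((0 : ℕ) = 0 ∧ gadget.Adj x y) ∨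
          (0 = 0 + 1 ∧ x = 15 ∧ y = 0) ∨ (0 = 0 + 1 ∧ y = 15 ∧ x = 0))
      simp

/-- Families of five connected sets in the block, pairwise adjacent except for the first two; the
hubs are numbered `16` and `17`. -/
def blockModels : List (Fin 5 → List (Fin 18)) :=
  [![[13, 12, 11, 10, 6, 2], [17, 16, 9, 8, 5, 3, 4, 1, 0], [7], [14], [15]],
    ![[9, 5, 4, 3], [17, 16, 15, 14, 13, 12, 11, 10, 7, 6, 2], [0], [1], [8]],
    ![[17, 16], [13, 12, 11, 10, 9, 8, 2, 6, 7, 5, 3, 4, 1], [0], [14], [15]],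
    ![[13, 12, 2], [17, 16, 14, 9, 8, 7, 5, 3, 4, 1, 0], [10, 6], [11], [15]],
    ![[13, 12, 10], [17, 16, 15, 14, 9, 8, 5, 3, 4, 1, 0], [6, 2], [7], [11]],
    ![[9, 3], [17, 16, 15, 14, 13, 12, 11, 10, 2, 6, 7, 1, 0], [4], [5], [8]],
    ![[12, 6], [17, 16, 11, 14, 9, 8, 5, 3, 4, 1, 0], [7, 15, 2], [10], [13]],
    ![[6], [17, 16, 13, 11, 14, 9, 8, 5, 3, 4, 1, 0], [7, 15, 2], [10], [12]],
    ![[9, 5, 3], [17, 16, 15, 14, 13, 12, 11, 10, 2, 6, 7, 1], [0], [4], [8]],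
    ![[3], [17, 16, 15, 14, 13, 12, 11, 10, 8, 2, 6, 7, 1, 0], [4], [5], [9]],
    ![[10], [17, 16, 2, 15, 14, 9, 8, 5, 3, 4, 1, 0], [11, 7, 6], [12], [13]],
    ![[16], [14, 13, 12, 11, 10, 9, 8, 2, 6, 7, 5, 3, 4, 1], [0], [15], [17]],
    ![[9, 5, 3, 4, 1], [16, 17, 14, 13, 12, 11, 10, 6, 2], [8, 0], [7], [15]],
    ![[9, 8, 5, 4, 3], [17, 16, 15, 13, 12, 11, 10, 6, 2], [1, 0], [7], [14]],
    ![[13, 12, 10, 7, 6, 2], [17, 16, 9, 5, 3, 4, 0], [8, 1], [14, 11], [15]]]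

/-- The vertices of the block, with the hubs numbered `16` and `17`. -/
def blockVertex (w : Fin 18) : Fin 2 ⊕ Fin 16 := (finSumFinEquiv (m := 16) (n := 2)).symm w |>.swap

theorem isListModel_blockModels :
    ∀ B ∈ blockModels, IsListModel ⊤ blockGraph
      (fun i j => (i = 0 ∧ j = 1) ∨ (i = 1 ∧ j = 0)) fun i => (B i).map blockVertex := by
  decide +kernel

theorem exists_mem_blockModels : ∀ a b, blockVertex a ≠ blockVertex b →
    ¬ blockGraph.Adj (blockVertex a) (blockVertex b) →
    ∃ B ∈ blockModels, (a ∈ B 0 ∧ b ∈ B 1) ∨ (b ∈ B 0 ∧ a ∈ B 1) := by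
  decide +kernel

theorem blockVertex_surjective : Function.Surjective blockVertex :=
  (Equiv.sumComm _ _).surjective.comp finSumFinEquiv.symm.surjective

theorem adj_sup_fromEdgeSet {V : Type} (G : SimpleGraph V) {u v : V} (h : u ≠ v) :
    (G ⊔ SimpleGraph.fromEdgeSet {s(u, v)}).Adj u v :=
  Or.inr ((SimpleGraph.fromEdgeSet_adj _).2 ⟨rfl, h⟩)

theorem nonempty_model_block {u v : Fin 2 ⊕ Fin 16} (huv : u ≠ v)
    (h : ¬ blockGraph.Adj u v) : Nonempty (MinorModel (⊤ : SimpleGraph (Fin 5))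
      (blockGraph ⊔ SimpleGraph.fromEdgeSet {s(u, v)})) := by
  obtain ⟨a, rfl⟩ := blockVertex_surjective u
  obtain ⟨b, rfl⟩ := blockVertex_surjective v
  have hadj := adj_sup_fromEdgeSet blockGraph huv
  obtain ⟨B, hB, hmem⟩ := exists_mem_blockModels a b huv h
  refine ⟨(isListModel_blockModels B hB).toMinorModel le_sup_left ?_⟩
  rintro _ _ (⟨rfl, rfl⟩ | ⟨rfl, rfl⟩) <;> rcases hmem with ⟨h0, h1⟩ | ⟨h0, h1⟩ <;>
    replace h0 := List.mem_map_of_mem (f := blockVertex) h0 <;>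
    replace h1 := List.mem_map_of_mem (f := blockVertex) h1
  exacts [⟨_, h0, _, h1, hadj⟩, ⟨_, h0, _, h1, hadj.symm⟩, ⟨_, h1, _, h0, hadj.symm⟩,
    ⟨_, h1, _, h0, hadj⟩]

theorem not_isPlanar_block {k : ℕ} (i : Fin k) {u v : Fin 2 ⊕ Fin 16}
    (huv : blockEmbedding i u ≠ blockEmbedding i v)
    (h : ¬ (finiteTower k).Adj (blockEmbedding i u) (blockEmbedding i v)) :
    ¬ IsPlanar (finiteTower k ⊔
      SimpleGraph.fromEdgeSet {s(blockEmbedding i u, blockEmbedding i v)}) := by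
  intro hP
  have hne : u ≠ v := fun h' => huv (h' ▸ rfl)
  obtain ⟨M⟩ := nonempty_model_block hne (fun h' => h ((blockEmbedding i).map_rel_iff.2 h'))
  refine hP.isEmpty_K5.elim (M.map ⟨blockEmbedding i, ?_⟩ (blockEmbedding i).injective)
  rintro a b (hab | hab)
  · exact Or.inl ((blockEmbedding i).map_rel_iff.2 hab)
  · obtain ⟨hab, hne'⟩ := (SimpleGraph.fromEdgeSet_adj _).1 hab
    refine Or.inr ((SimpleGraph.fromEdgeSet_adj _).2
      ⟨?_, fun h' => hne' ((blockEmbedding i).injective h')⟩)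
    exact congrArg (Sym2.map (blockEmbedding i)) hab

/-! ### Edge-maximality: two vertices in distinct levels -/

/-- The vertices of a gadget that are adjacent to both hubs. -/
def IsPole (x : Fin 16) : Prop := x = 0 ∨ x = 15

/-- Three connected, pairwise adjacent sets that are all adjacent to both hubs form a `K₅`-minor
together with the hubs. -/
theorem not_isPlanar_of_three {k : ℕ} {G : SimpleGraph (Fin 2 ⊕ Fin k × Fin 16)}
    (hG : finiteTower k ≤ G) {A B C : Set (Fin k × Fin 16)}
    (hA : ((G.comap Sum.inr).induce A).Connected) (hB : ((G.comap Sum.inr).induce B).Connected)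
    (hC : ((G.comap Sum.inr).induce C).Connected)
    (hAB : Disjoint A B) (hAC : Disjoint A C) (hBC : Disjoint B C)
    (hpA : ∃ p ∈ A, IsPole p.2) (hpB : ∃ p ∈ B, IsPole p.2) (hpC : ∃ p ∈ C, IsPole p.2)
    (hadjAB : ∃ u ∈ A, ∃ v ∈ B, G.Adj (.inr u) (.inr v))
    (hadjAC : ∃ u ∈ A, ∃ v ∈ C, G.Adj (.inr u) (.inr v))
    (hadjBC : ∃ u ∈ B, ∃ v ∈ C, G.Adj (.inr u) (.inr v)) : ¬ IsPlanar G := by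
  intro hP
  let f : G.comap Sum.inr →g G := ⟨Sum.inr, fun h => h⟩
  have hub : ∀ h : Fin 2, ∀ {D : Set (Fin k × Fin 16)}, (∃ p ∈ D, IsPole p.2) →
      ∃ u ∈ ({.inl h} : Set (Fin 2 ⊕ Fin k × Fin 16)), ∃ v ∈ Sum.inr '' D, G.Adj u v := by
    rintro h D ⟨⟨i, x⟩, hp, hx⟩
    refine ⟨_, rfl, _, ⟨_, hp, rfl⟩, hG ?_⟩
    rcases hx with hx | hx
    exacts [Or.inl hx, Or.inr (Or.inl hx)]
  have img : ∀ {D D' : Set (Fin k × Fin 16)}, (∃ u ∈ D, ∃ v ∈ D', G.Adj (.inr u) (.inr v)) →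
      ∃ u ∈ Sum.inr '' D, ∃ v ∈ Sum.inr '' D', G.Adj u v := by
    rintro D D' ⟨u, hu, v, hv, h⟩
    exact ⟨_, ⟨u, hu, rfl⟩, _, ⟨v, hv, rfl⟩, h⟩
  have hubDisj : ∀ (h : Fin 2) (D : Set (Fin k × Fin 16)),
      Disjoint ({.inl h} : Set (Fin 2 ⊕ Fin k × Fin 16)) (Sum.inr '' D) := by
    intro h D
    simp
  have imgDisj : ∀ {D D' : Set (Fin k × Fin 16)}, Disjoint D D' →
      Disjoint (Sum.inr '' D : Set (Fin 2 ⊕ Fin k × Fin 16)) (Sum.inr '' D') :=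
    fun h => Set.disjoint_image_of_injective Sum.inr_injective h
  let branch : Fin 5 → Set (Fin 2 ⊕ Fin k × Fin 16) :=
    ![{.inl 0}, {.inl 1}, Sum.inr '' A, Sum.inr '' B, Sum.inr '' C]
  have hlt : ∀ i j, i < j → Disjoint (branch i) (branch j) ∧
      ∃ u ∈ branch i, ∃ v ∈ branch j, G.Adj u v := by
    have h01 : ∃ u ∈ ({.inl 0} : Set (Fin 2 ⊕ Fin k × Fin 16)),
        ∃ v ∈ ({.inl 1} : Set (Fin 2 ⊕ Fin k × Fin 16)), G.Adj u v :=
      ⟨_, rfl, _, rfl, hG (show (0 : Fin 2) ≠ 1 by decide)⟩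
    intro i j hij
    fin_cases i <;> fin_cases j <;> first
      | exact absurd hij (by decide)
      | exact ⟨hubDisj _ _, hub _ ‹_›⟩
      | exact ⟨imgDisj ‹_›, img ‹_›⟩
      | exact ⟨by simp [branch], h01⟩
  refine hP.isEmpty_K5.elim ⟨branch, fun i => ?_, fun i j hij => ?_, fun i j hij => ?_⟩
  · fin_cases i
    exacts [connected_induce_singleton _ _, connected_induce_singleton _ _,
      connected_induce_image f hA, connected_induce_image f hB, connected_induce_image f hC]
  · rcases hij.lt_or_gt with h | h
    exacts [(hlt i j h).1, (hlt j i h).1.symm]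
  · rcases hij.ne.lt_or_gt with h | h
    · exact (hlt i j h).2
    · obtain ⟨u, hu, v, hv, huv⟩ := (hlt j i h).2
      exact ⟨v, hv, u, hu, huv.symm⟩

theorem connected_induce_gadget : (gadget.induce Set.univ).Connected := by
  have h : {x : Fin 16 | x ∈ [9, 3, 10, 13, 12, 8, 5, 4, 14, 11, 7, 6, 2, 1, 0, 15]} = Set.univ :=
    Set.eq_univ_of_forall (by decide)
  rw [← h]
  exact ListConnected.connected (by decide +kernel)

theorem connected_induce_gadget_ne_zero : (gadget.induce {x | x ≠ 0}).Connected := by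
  have h : {x : Fin 16 | x ∈ [9, 5, 3, 10, 13, 12, 8, 4, 14, 11, 7, 6, 2, 1, 15]} =
      {x | x ≠ 0} :=
    Set.ext (by decide)
  rw [← h]
  exact ListConnected.connected (by decide +kernel)

theorem connected_induce_gadget_ne_last : (gadget.induce {x | x ≠ 15}).Connected := by
  have h : {x : Fin 16 | x ∈ [12, 3, 13, 2, 9, 10, 6, 5, 4, 1, 11, 8, 7, 0, 14]} =
      {x | x ≠ 15} :=
    Set.ext (by decide)
  rw [← h]
  exact ListConnected.connected (by decide +kernel)

/-- The tower without the hubs. -/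
abbrev hubless (k : ℕ) : SimpleGraph (Fin k × Fin 16) := (finiteTower k).comap Sum.inr

theorem connected_induce_level {k : ℕ} (i : Fin k) {A : Set (Fin 16)}
    (hA : (gadget.induce A).Connected) : ((hubless k).induce (Prod.mk i '' A)).Connected :=
  connected_induce_image (G' := hubless k)
    ⟨Prod.mk i, fun h => (levelEmbedding i).map_rel_iff.2 h⟩ hA

theorem hubless_adj_succ {k : ℕ} {i j : Fin k} (h : (j : ℕ) = i + 1) :
    (hubless k).Adj (i, 15) (j, 0) :=
  Or.inr (Or.inl ⟨h, rfl, rfl⟩)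

/-- The vertices at levels `m, …, n`, except for the vertex `0` at level `m`. -/
def stack (k m n : ℕ) : Set (Fin k × Fin 16) :=
  {p | m ≤ p.1 ∧ p.1 ≤ n ∧ ¬ ((p.1 : ℕ) = m ∧ p.2 = 0)}

theorem connected_induce_stack {k m n : ℕ} (hmn : m ≤ n) (hn : n < k) :
    ((hubless k).induce (stack k m n)).Connected := by
  induction n, hmn using Nat.le_induction with
  | base =>
    have h : stack k m m = Prod.mk ⟨m, hn⟩ '' {x | x ≠ 0} := by
      ext ⟨i, x⟩
      simp only [stack, Set.mem_ofPred_eq, Set.mem_image, Prod.mk.injEq, Fin.ext_iff]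
      grind
    rw [h]
    exact connected_induce_level _ connected_induce_gadget_ne_zero
  | succ n hmn ih =>
    have h : stack k m (n + 1) = stack k m n ∪ Prod.mk ⟨n + 1, hn⟩ '' Set.univ := by
      ext ⟨i, x⟩
      simp only [stack, Set.mem_ofPred_eq, Set.mem_image, Set.mem_union, Prod.mk.injEq,
        Fin.ext_iff]
      grind
    rw [h]
    refine connected_induce_union_of_adj (ih (by omega))
      (connected_induce_level _ connected_induce_gadget)
      ⟨(⟨n, by omega⟩, 15), ⟨hmn, le_rfl, by simp⟩, (⟨n + 1, hn⟩, 0), ⟨0, trivial, rfl⟩,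
        hubless_adj_succ rfl⟩

theorem not_isPlanar_levels {k : ℕ} {i j : Fin k} {x y : Fin 16} (hij : i < j)
    (h : ¬ (finiteTower k).Adj (.inr (i, x)) (.inr (j, y))) :
    ¬ IsPlanar (finiteTower k ⊔ SimpleGraph.fromEdgeSet {s(.inr (i, x), .inr (j, y))}) := by
  have hle : finiteTower k ≤
      finiteTower k ⊔ SimpleGraph.fromEdgeSet {s(.inr (i, x), .inr (j, y))} := le_sup_left
  have hadj := adj_sup_fromEdgeSet (finiteTower k)
    (u := .inr (i, x)) (v := .inr (j, y)) (by simp [hij.ne])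
  generalize finiteTower k ⊔ SimpleGraph.fromEdgeSet {s(.inr (i, x), .inr (j, y))} = G at *
  have hle' : hubless k ≤ G.comap Sum.inr := fun _ _ h' => hle h'
  have hij' : (i : ℕ) + 1 ≤ j := hij
  have hgad : ∀ (l : Fin k) {z w : Fin 16}, gadget.Adj z w →
      G.Adj (.inr (l, z)) (.inr (l, w)) := fun l _ _ h' =>
    hle ((levelEmbedding l).map_rel_iff.2 h')
  by_cases hv : (j : ℕ) = i + 1 ∧ y = 0
  · obtain ⟨hj, rfl⟩ := hv
    have hx : x ≠ 15 := by
      rintro rfl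
      exact h (hubless_adj_succ hj)
    refine not_isPlanar_of_three hle (A := {(i, 15)}) (B := Prod.mk i '' {x | x ≠ 15})
      (C := {(j, 0)}) (connected_induce_singleton _ _)
      ((connected_induce_level i connected_induce_gadget_ne_last).mono fun _ _ h' => hle' h')
      (connected_induce_singleton _ _) (by simp) (by simp) (by simp [hij.ne])
      ⟨_, rfl, Or.inr rfl⟩ ⟨_, ⟨0, by simp, rfl⟩, Or.inl rfl⟩ ⟨_, rfl, Or.inl rfl⟩
      ⟨_, rfl, _, ⟨0, by simp, rfl⟩, hgad i (by decide)⟩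
      ⟨_, rfl, _, rfl, hle (hubless_adj_succ hj)⟩
      ⟨_, ⟨x, hx, rfl⟩, _, rfl, hadj⟩
  · let l : Fin k := ⟨i + 1, by omega⟩
    refine not_isPlanar_of_three hle (A := {(l, 0)}) (B := Prod.mk i '' Set.univ)
      (C := stack k (i + 1) j) (connected_induce_singleton _ _)
      ((connected_induce_level i connected_induce_gadget).mono fun _ _ h' => hle' h')
      ((connected_induce_stack hij' j.2).mono fun _ _ h' => hle' h') ?_ ?_ ?_
      ⟨_, rfl, Or.inl rfl⟩ ⟨_, ⟨0, trivial, rfl⟩, Or.inl rfl⟩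
      ⟨(l, 15), ⟨le_rfl, hij', by simp⟩, Or.inr rfl⟩
      ⟨_, rfl, _, ⟨15, trivial, rfl⟩, (hle' (hubless_adj_succ rfl)).symm⟩
      ⟨_, rfl, (l, 15), ⟨le_rfl, hij', by simp⟩, hgad l (by decide)⟩
      ⟨_, ⟨x, trivial, rfl⟩, _, ⟨hij', le_rfl, hv⟩, hadj⟩
    · rw [Set.disjoint_singleton_left]
      rintro ⟨z, -, hz⟩
      have : (i : ℕ) = i + 1 := congrArg (fun p => (p.1 : ℕ)) hz
      omega
    · rw [Set.disjoint_singleton_left]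
      exact fun h' => h'.2.2 ⟨rfl, rfl⟩
    · rw [Set.disjoint_left]
      rintro _ ⟨z, -, rfl⟩ ⟨h1, -⟩
      exact absurd h1 (by simp)

theorem isPlaneTriangulation_finiteTower {k : ℕ} (hk : 0 < k) :
    IsPlaneTriangulation (finiteTower k) := by
  refine ⟨⟨finiteTowerEmbedding k⟩, ?_⟩
  rintro (h | ⟨i, x⟩) (h' | ⟨j, y⟩) huv hadj
  · exact not_isPlanar_block ⟨0, hk⟩ (u := .inl h) (v := .inl h') huv hadj
  · exact not_isPlanar_block j (u := .inl h) (v := .inr y) huv hadj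
  · exact not_isPlanar_block i (u := .inr x) (v := .inl h') huv hadj
  · rcases lt_trichotomy i j with hij | rfl | hij
    · exact not_isPlanar_levels hij hadj
    · exact not_isPlanar_block i (u := .inr x) (v := .inr y) huv hadj
    · rw [Sym2.eq_swap]
      exact not_isPlanar_levels hij fun h => hadj h.symm

/-! ### Large induced subgraphs -/

/-- A perfect elimination ordering of the gadget without the vertices `4`, `7`, `10` and `15`. -/
def eliminationOrder : List (Fin 16) := [1, 3, 6, 9, 5, 0, 8, 14, 11, 2, 12, 13]

theorem gadget_elimination_ne : ∀ x ∈ eliminationOrder, ∀ y ∈ eliminationOrder, gadget.Adj x y →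
    eliminationOrder.idxOf x ≠ eliminationOrder.idxOf y := by decide +kernel

theorem gadget_elimination_adj : ∀ v ∈ eliminationOrder,
    ∀ x ∈ eliminationOrder, gadget.Adj v x → eliminationOrder.idxOf v < eliminationOrder.idxOf x →
    ∀ y ∈ eliminationOrder, gadget.Adj v y → eliminationOrder.idxOf v < eliminationOrder.idxOf y →
    x ≠ y → gadget.Adj x y := by decide +kernel

theorem gadget_elimination_three : ∀ v ∈ eliminationOrder,
    ∀ x ∈ eliminationOrder, gadget.Adj v x → eliminationOrder.idxOf v < eliminationOrder.idxOf x →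
    ∀ y ∈ eliminationOrder, gadget.Adj v y → eliminationOrder.idxOf v < eliminationOrder.idxOf y →
    ∀ z ∈ eliminationOrder, gadget.Adj v z → eliminationOrder.idxOf v < eliminationOrder.idxOf z →
    x ≠ y → x ≠ z → y ≠ z → False := by decide +kernel

theorem le_sK4_finiteTower (k : ℕ) : 12 * k ≤ sK4 (finiteTower k) := by
  let S : Finset (Fin 2 ⊕ Fin k × Fin 16) :=
    ((Finset.univ : Finset (Fin k)) ×ˢ eliminationOrder.toFinset).map Function.Embedding.inr
  have hcard : S.card = 12 * k := by
    rw [Finset.card_map, Finset.card_product, Finset.card_univ, Fintype.card_fin, mul_comm]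
    rfl
  have hS : ∀ v : (S : Set (Fin 2 ⊕ Fin k × Fin 16)),
      ∃ i, ∃ x ∈ eliminationOrder, v.1 = .inr (i, x) := by
    rintro ⟨v, hv⟩
    obtain ⟨⟨i, x⟩, hp, rfl⟩ := Finset.mem_map.1 (Finset.mem_coe.1 hv)
    exact ⟨i, x, by simpa using (Finset.mem_product.1 hp).2, rfl⟩
  choose lev ver hver hval using hS
  have hadj : ∀ {u v}, ((finiteTower k).induce (S : Set (Fin 2 ⊕ Fin k × Fin 16))).Adj u v →
      lev u = lev v ∧ gadget.Adj (ver u) (ver v) := by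
    intro u v huv
    have huv : (finiteTower k).Adj u.1 v.1 := huv
    have h15 : (15 : Fin 16) ∉ eliminationOrder := by decide
    rw [hval, hval] at huv
    rcases huv with ⟨h1, h2⟩ | ⟨-, h2, -⟩ | ⟨-, h2, -⟩
    · exact ⟨Fin.ext h1, h2⟩
    · exact absurd (h2 ▸ hver u) h15
    · exact absurd (h2 ▸ hver v) h15
  have hinj : ∀ {u v}, lev u = lev v → u ≠ v → ver u ≠ ver v := by
    intro u v hl huv h
    exact huv (Subtype.ext (by rw [hval, hval, hl, h]))
  have hfree : K4MinorFree ((finiteTower k).induce (S : Set (Fin 2 ⊕ Fin k × Fin 16))) := by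
    refine k4MinorFree_of_elimination (fun v => eliminationOrder.idxOf (ver v)) ?_ ?_ ?_
    · intro u v huv
      exact gadget_elimination_ne _ (hver u) _ (hver v) (hadj huv).2
    · intro v x y hx hy hrx hry hxy
      have hl : lev x = lev y := (hadj hx).1.symm.trans (hadj hy).1
      have h := gadget_elimination_adj _ (hver v) _ (hver x) (hadj hx).2 hrx _ (hver y)
        (hadj hy).2 hry (hinj hl hxy)
      change (finiteTower k).Adj x.1 y.1
      rw [hval, hval, hl]
      exact Or.inl ⟨rfl, h⟩
    · intro v x y z hx hy hz hrx hry hrz hxy hxz hyz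
      exact gadget_elimination_three _ (hver v) _ (hver x) (hadj hx).2 hrx _ (hver y)
        (hadj hy).2 hry _ (hver z) (hadj hz).2 hrz
        (hinj ((hadj hx).1.symm.trans (hadj hy).1) hxy)
        (hinj ((hadj hx).1.symm.trans (hadj hz).1) hxz)
        (hinj ((hadj hy).1.symm.trans (hadj hz).1) hyz)
  refine le_csSup ⟨Fintype.card (Fin 2 ⊕ Fin k × Fin 16), ?_⟩ ⟨S, hfree, hcard⟩
  rintro _ ⟨T, -, rfl⟩
  exact Finset.card_le_univ T

theorem sO_finiteTower_le (k : ℕ) : sO (finiteTower k) ≤ 11 * k + 2 := by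
  refine csSup_le' ?_
  rintro _ ⟨S, hS, rfl⟩
  have hlevel : ∀ i ∈ (Finset.univ : Finset (Fin k)),
      (S.toRight.filter fun p => p.1 = i).card ≤ 11 := by
    intro i _
    let T : Finset (Fin 16) := Finset.univ.filter fun x => Sum.inr (i, x) ∉ S
    have hT : 5 ≤ T.card := by
      refine five_le_card_of_isOuterplanar hS (levelEmbedding i).toHom
        (levelEmbedding i).injective T fun x hx => ?_
      change Sum.inr (i, x) ∈ S
      simpa [T] using hx
    have hle : (S.toRight.filter fun p => p.1 = i).card ≤ Tᶜ.card := by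
      refine Finset.card_le_card_of_injOn Prod.snd ?_ ?_
      · rintro ⟨j, x⟩ hp
        simp only [Finset.coe_filter, Finset.mem_toRight, Set.mem_ofPred_eq] at hp
        obtain ⟨hp, rfl⟩ := hp
        simpa [T] using hp
      · rintro ⟨j, x⟩ hp ⟨j', y⟩ hp' hxy
        simp only [Finset.coe_filter, Set.mem_ofPred_eq] at hp hp'
        exact Prod.ext (hp.2.trans hp'.2.symm) hxy
    rw [Finset.card_compl, Fintype.card_fin] at hle
    omega
  have hright : S.toRight.card ≤ 11 * (Finset.univ : Finset (Fin k)).card :=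
    Finset.card_le_mul_card_image_of_maps_to (fun p _ => Finset.mem_univ p.1) 11 hlevel
  have hleft : S.toLeft.card ≤ 2 := S.toLeft.card_le_univ
  rw [Finset.card_univ, Fintype.card_fin] at hright
  rw [← Finset.card_toLeft_add_card_toRight]
  omega

/-- There is a fixed 16-vertex gadget `H` such that for every even
`k ≥ 4` there is a plane triangulation `D_k` containing `k` pairwise disjoint copies of
`H`, with `s_{K₄}(D_k) ≥ 12k` and `s_o(D_k) ≤ 23k/2`; in particular
`s_{K₄}(D_k) − s_o(D_k) ≥ k/2`. -/
theorem stmt5 :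
    ∃ H : SimpleGraph (Fin 16), ∀ k : ℕ, 4 ≤ k → Even k →
      ∃ (V : Type) (inst : Fintype V) (G : SimpleGraph V) (_ : PlaneEmbedding G),
        IsPlaneTriangulation G ∧
        (∃ f : Fin k → (H ↪g G),
          Pairwise (fun i j => Disjoint (Set.range ⇑(f i)) (Set.range ⇑(f j)))) ∧
        12 * k ≤ @sK4 V inst G ∧
        2 * @sO V inst G ≤ 23 * k ∧
        2 * @sO V inst G + k ≤ 2 * @sK4 V inst G := by
  refine ⟨gadget, fun k hk _ => ⟨_, inferInstance, finiteTower k, finiteTowerEmbedding k,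
    isPlaneTriangulation_finiteTower (by omega), ⟨levelEmbedding, ?_⟩, ?_⟩⟩
  · intro i j hij
    rw [Set.disjoint_left]
    rintro _ ⟨x, rfl⟩ ⟨y, hy⟩
    exact hij (congrArg Prod.fst (Sum.inr_injective hy)).symm
  · have h1 := le_sK4_finiteTower k
    have h2 := sO_finiteTower_le k
    refine ⟨h1, ?_, ?_⟩ <;> omega
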